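/- arXiv:2603.21197 — 10 statements merged into one kernel-verified Lean document; each statement's English description precedes it below -/
import Mathlib

section
/- For every h ∈ ℋ := conv{γ_1,…,γ_d}, the map T_h(x) := x/(1 + hᵀx) is a bijection from A_h := {x ∈ 𝒳_d : 1 + hᵀx > 0} onto 𝒴_h := {y ∈ ℝ^{d−1} : 1 + (γ_i − h)ᵀy ≥ 0 for all i}, with inverse S_h(y) := y/(1 − hᵀy). Moreover: (i) 1 − hᵀy > 0 for every y ∈ 𝒴_h; (ii) S_h(𝒴_h) ⊆ 𝒳_d and T_h(A_h) ⊆ 𝒴_h; (iii) if h is in the interior of ℋ, then A_h = 𝒳_d; (iv) if h is in the boundary of ℋ, then 𝒴_h is unbounded. -/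
open Finset

theorem aux_gram (d : ℕ) (hd : 2 ≤ d)
    (H : Matrix (Fin d) (Fin (d - 1)) ℝ)
    (horth : H.transpose * H = 1)
    (hcolsum : ∀ j, ∑ i, H i j = 0) (i k : Fin d) :
    ∑ j, H i j * H k j = (if i = k then 1 else 0) - 1 / (d : ℝ) := by
  have hd0 : (0 : ℝ) < d := by positivity
  obtain ⟨B, hBl, hBr⟩ : ∃ B : Matrix (Fin d) (Fin (d - 1) ⊕ Unit) ℝ,
      (∀ i j, B i (Sum.inl j) = H i j) ∧ (∀ i u, B i (Sum.inr u) = (√(d : ℝ))⁻¹) :=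
    ⟨Matrix.of fun i c => Sum.elim (fun j => H i j) (fun _ => (√(d : ℝ))⁻¹) c,
      fun _ _ => rfl, fun _ _ => rfl⟩
  have hs : (√(d : ℝ))⁻¹ * (√(d : ℝ))⁻¹ = 1 / (d : ℝ) := by
    rw [← mul_inv, Real.mul_self_sqrt hd0.le, one_div]
  have h1 : B.transpose * B = 1 := by
    ext a b
    rcases a with a | a <;> rcases b with b | b
    · have := congrFun (congrFun horth a) b
      simpa [Matrix.mul_apply, hBl, hBr, Matrix.one_apply] using this
    · simp [Matrix.mul_apply, hBl, hBr, Matrix.one_apply, ← Finset.sum_mul, hcolsum]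
    · simp [Matrix.mul_apply, hBl, hBr, Matrix.one_apply, ← Finset.mul_sum, hcolsum]
    · simp [Matrix.mul_apply, hBl, hBr, Matrix.one_apply, hs]
      field_simp
  have h2 : B * B.transpose = 1 := by
    rw [Matrix.mul_eq_one_comm_of_card_eq]
    · exact h1
    · simp; omega
  have h3 := congrFun (congrFun h2 i) k
  simp only [Matrix.mul_apply, hBl, hBr, Matrix.one_apply, Matrix.transpose_apply, Fintype.sum_sum_type,
    Finset.univ_unique, Finset.sum_singleton, hs] at h3
  linarith

theorem aux_recon (d : ℕ)
    (H : Matrix (Fin d) (Fin (d - 1)) ℝ)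
    (horth : H.transpose * H = 1) (y : Fin (d - 1) → ℝ) (l : Fin (d - 1)) :
    ∑ i, (∑ j, H i j * y j) * H i l = y l := by
  have h0 : H.transpose.mulVec (H.mulVec y) = y := by
    rw [Matrix.mulVec_mulVec, horth, Matrix.one_mulVec]
  have := congrFun h0 l
  simp only [Matrix.mulVec, dotProduct, Matrix.transpose_apply] at this
  rw [← this]
  exact Finset.sum_congr rfl fun i _ => mul_comm _ _

theorem aux_sum0 (d : ℕ)
    (H : Matrix (Fin d) (Fin (d - 1)) ℝ)
    (hcolsum : ∀ j, ∑ i, H i j = 0) (y : Fin (d - 1) → ℝ) :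
    ∑ i, ∑ j, H i j * y j = 0 := by
  rw [Finset.sum_comm]
  simp [← Finset.sum_mul, hcolsum]

theorem aux_smul {n : ℕ} (a y : Fin n → ℝ) (c : ℝ) :
    ∑ j, a j * (c • y) j = c * ∑ j, a j * y j := by
  rw [Finset.mul_sum]
  exact Finset.sum_congr rfl fun i _ => by simp; ring

theorem aux_sub {n : ℕ} (a b y : Fin n → ℝ) :
    ∑ j, (a j - b j) * y j = ∑ j, a j * y j - ∑ j, b j * y j := by
  rw [← Finset.sum_sub_distrib]
  exact Finset.sum_congr rfl fun i _ => by ring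

theorem aux_pos (d : ℕ) (hd : 2 ≤ d)
    (H : Matrix (Fin d) (Fin (d - 1)) ℝ)
    (horth : H.transpose * H = 1)
    (hcolsum : ∀ j, ∑ i, H i j = 0)
    (h y : Fin (d - 1) → ℝ)
    (hy : ∀ i, 0 ≤ 1 + ∑ j, (H i j - h j) * y j) : 0 < 1 - ∑ j, h j * y j := by
  have hd0 : (0 : ℝ) < d := by positivity
  by_contra hneg
  push Not at hneg
  have hge : ∀ i, 0 ≤ ∑ j, H i j * y j := fun i => by
    have := hy i
    rw [aux_sub] at this
    linarith
  have hz := (Finset.sum_eq_zero_iff_of_nonneg (fun i _ => hge i)).1 (aux_sum0 d H hcolsum y)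
  have hy0 : ∀ l, y l = 0 := fun l => by
    rw [← aux_recon d H horth y l]
    exact Finset.sum_eq_zero fun i hi => by rw [hz i hi, zero_mul]
  simp [hy0] at hneg
  linarith

theorem aux_hull_nonneg (d : ℕ)
    (H : Matrix (Fin d) (Fin (d - 1)) ℝ) (x z : Fin (d - 1) → ℝ)
    (hx : ∀ i, 0 ≤ 1 + ∑ j, H i j * x j)
    (hz : z ∈ convexHull ℝ (Set.range fun i : Fin d => fun j => H i j)) :
    0 ≤ 1 + ∑ j, z j * x j := by
  have hconv : Convex ℝ {z : Fin (d - 1) → ℝ | 0 ≤ 1 + ∑ j, z j * x j} := by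
    intro a ha b hb s t hs ht hst
    simp only [Set.mem_ofPred_eq] at *
    have : ∑ j, (s • a + t • b) j * x j = s * ∑ j, a j * x j + t * ∑ j, b j * x j := by
      rw [Finset.mul_sum, Finset.mul_sum, ← Finset.sum_add_distrib]
      exact Finset.sum_congr rfl fun i _ => by simp; ring
    rw [this]
    nlinarith [mul_nonneg hs ha, mul_nonneg ht hb]
  refine convexHull_min ?_ hconv hz
  rintro _ ⟨i, rfl⟩
  exact hx i

theorem aux_mem_hull (d : ℕ) (hd : 2 ≤ d)
    (H : Matrix (Fin d) (Fin (d - 1)) ℝ)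
    (horth : H.transpose * H = 1)
    (hcolsum : ∀ j, ∑ i, H i j = 0) (z : Fin (d - 1) → ℝ)
    (hz : ∀ i, 0 ≤ 1 / (d : ℝ) + ∑ j, H i j * z j) :
    z ∈ convexHull ℝ (Set.range fun i : Fin d => fun j => H i j) := by
  have hd0 : (0 : ℝ) < d := by positivity
  have hzz : z = ∑ i, (1 / (d : ℝ) + ∑ j, H i j * z j) • (fun j => H i j) := by
    ext l
    simp only [Finset.sum_apply, Pi.smul_apply, smul_eq_mul, add_mul, Finset.sum_add_distrib]
    rw [aux_recon d H horth z l, ← Finset.mul_sum, hcolsum]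
    simp
  rw [hzz]
  refine (convex_convexHull ℝ _).sum_mem (fun i _ => hz i) ?_
    (fun i _ => subset_convexHull ℝ _ ⟨i, rfl⟩)
  rw [Finset.sum_add_distrib, aux_sum0 d H hcolsum z]
  simp
  field_simp

theorem aux_interior (d : ℕ) 
    (H : Matrix (Fin d) (Fin (d - 1)) ℝ) (h x : Fin (d - 1) → ℝ)
    (hx : ∀ i, 0 ≤ 1 + ∑ j, H i j * x j)
    (hz : h ∈ interior (convexHull ℝ (Set.range fun i : Fin d => fun j => H i j))) :
    0 < 1 + ∑ j, h j * x j := by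
  have hc : ContinuousAt (fun t : ℝ => h - t • x) 0 := by fun_prop
  have hev : ∀ᶠ t : ℝ in nhds 0,
      h - t • x ∈ convexHull ℝ (Set.range fun i : Fin d => fun j => H i j) := by
    apply hc
    simpa using mem_interior_iff_mem_nhds.1 hz
  obtain ⟨ε, hε, hball⟩ := Metric.eventually_nhds_iff.1 hev
  have hm := hball (y := ε / 2) (by
    rw [Real.dist_eq, sub_zero, abs_of_pos (by positivity)]; linarith)
  have h1 := aux_hull_nonneg d H x _ hx hm
  have h2 : ∑ j, (h - (ε / 2) • x) j * x j = ∑ j, h j * x j - (ε / 2) * ∑ j, x j * x j := by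
    rw [Finset.mul_sum, ← Finset.sum_sub_distrib]
    exact Finset.sum_congr rfl fun i _ => by simp; ring
  rw [h2] at h1
  have hnn : 0 ≤ ∑ j, x j * x j := Finset.sum_nonneg fun j _ => mul_self_nonneg _
  rcases hnn.eq_or_lt with h0 | h0
  · have hx0 := (Finset.sum_eq_zero_iff_of_nonneg (fun j _ => mul_self_nonneg (x j))).1 h0.symm
    have : ∑ j, h j * x j = 0 := Finset.sum_eq_zero fun j hj => by
      rw [mul_self_eq_zero.1 (hx0 j hj), mul_zero]
    linarith
  · have : 0 < ε / 2 * ∑ j, x j * x j := by positivity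
    linarith

theorem aux_unbdd (d : ℕ) (hd : 2 ≤ d)
    (H : Matrix (Fin d) (Fin (d - 1)) ℝ)
    (horth : H.transpose * H = 1)
    (hcolsum : ∀ j, ∑ i, H i j = 0) (h : Fin (d - 1) → ℝ)
    (hz : h ∉ interior (convexHull ℝ (Set.range fun i : Fin d => fun j => H i j))) :
    ¬ Bornology.IsBounded {y : Fin (d - 1) → ℝ | ∀ i, 0 ≤ 1 + ∑ j, (H i j - h j) * y j} := by
  have hd2 : (2 : ℝ) ≤ d := by exact_mod_cast hd
  have hd0 : (0 : ℝ) < d := by linarith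
  obtain ⟨k, hk⟩ : ∃ k, 1 / (d : ℝ) + ∑ j, H k j * h j ≤ 0 := by
    by_contra hcon
    push Not at hcon
    apply hz
    have hopen : IsOpen {z : Fin (d - 1) → ℝ | ∀ i, 0 < 1 / (d : ℝ) + ∑ j, H i j * z j} := by
      simp only [Set.ofPred_forall]
      refine isOpen_iInter_of_finite fun i => isOpen_lt continuous_const (by fun_prop)
    refine mem_interior.2 ⟨_, ?_, hopen, hcon⟩
    intro z hz'
    exact aux_mem_hull d hd H horth hcolsum z fun i => (hz' i).le
  let g : Fin (d - 1) → ℝ := fun j => H k j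
  have hg : g ≠ 0 := by
    intro h0
    have h1 := aux_gram d hd H horth hcolsum k k
    have h2 : ∀ j, H k j = 0 := fun j => congrFun h0 j
    simp [h2] at h1
    have : (d : ℝ)⁻¹ < 1 := inv_lt_one_of_one_lt₀ (by linarith)
    linarith
  have hgn : 0 < ‖g‖ := norm_pos_iff.2 hg
  intro hb
  obtain ⟨C, hC⟩ := hb.exists_norm_le
  have hC0 : 0 ≤ C := (norm_nonneg _).trans (hC 0 (by simp))
  have hmem := hC (((C + 1) / ‖g‖) • g) (by
    intro i
    rw [aux_smul (fun j => H i j - h j) g, aux_sub]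
    have h1 : ∑ j, H i j * g j = _ := aux_gram d hd H horth hcolsum i k
    have h2 : ∑ j, h j * g j = ∑ j, H k j * h j := Finset.sum_congr rfl fun j _ => mul_comm _ _
    rw [h1, h2]
    have h3 : (0 : ℝ) ≤ if i = k then 1 else 0 := by split_ifs <;> norm_num
    have h4 : 0 ≤ (C + 1) / ‖g‖ * ((if i = k then (1 : ℝ) else 0) - 1 / (d : ℝ)
        - ∑ j, H k j * h j) := mul_nonneg (by positivity) (by linarith)
    linarith)
  rw [norm_smul, Real.norm_of_nonneg (by positivity), div_mul_cancel₀ _ hgn.ne'] at hmem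
  linarith

/-- For every `h ∈ ℋ := conv{γ₁,…,γ_d}`, the map
`T_h(x) := x/(1 + hᵀx)` is a bijection from `A_h := {x ∈ 𝒳_d : 1 + hᵀx > 0}` onto
`𝒴_h := {y : 1 + (γᵢ - h)ᵀy ≥ 0 ∀ i}`, with inverse `S_h(y) := y/(1 - hᵀy)`.
Moreover: (i) `1 - hᵀy > 0` on `𝒴_h`; (ii) `S_h(𝒴_h) ⊆ 𝒳_d` and `T_h(A_h) ⊆ 𝒴_h`;
(iii) if `h ∈ int ℋ` then `A_h = 𝒳_d`; (iv) if `h ∈ ∂ℋ` then `𝒴_h` is unbounded. -/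
theorem stmt3 (d : ℕ) (hd : 2 ≤ d)
    (H : Matrix (Fin d) (Fin (d - 1)) ℝ)
    (horth : H.transpose * H = 1)
    (hcolsum : ∀ j, ∑ i, H i j = 0)
    (h : Fin (d - 1) → ℝ)
    (hh : h ∈ convexHull ℝ (Set.range fun i : Fin d => fun j => H i j)) :
    let 𝒳 : Set (Fin (d - 1) → ℝ) := {x | ∀ i, 0 ≤ 1 + ∑ j, H i j * x j}
    let ℋ : Set (Fin (d - 1) → ℝ) := convexHull ℝ (Set.range fun i : Fin d => fun j => H i j)
    let Ah : Set (Fin (d - 1) → ℝ) := {x ∈ 𝒳 | 0 < 1 + ∑ j, h j * x j}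
    let Yh : Set (Fin (d - 1) → ℝ) := {y | ∀ i, 0 ≤ 1 + ∑ j, (H i j - h j) * y j}
    let T : (Fin (d - 1) → ℝ) → (Fin (d - 1) → ℝ) := fun x => (1 + ∑ j, h j * x j)⁻¹ • x
    let S : (Fin (d - 1) → ℝ) → (Fin (d - 1) → ℝ) := fun y => (1 - ∑ j, h j * y j)⁻¹ • y
    Set.BijOn T Ah Yh ∧
    (∀ x ∈ Ah, S (T x) = x) ∧
    (∀ y ∈ Yh, T (S y) = y) ∧
    (∀ y ∈ Yh, 0 < 1 - ∑ j, h j * y j) ∧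
    S '' Yh ⊆ 𝒳 ∧
    T '' Ah ⊆ Yh ∧
    (h ∈ interior ℋ → Ah = 𝒳) ∧
    (h ∈ frontier ℋ → ¬ Bornology.IsBounded Yh) := by
  intro 𝒳 ℋ Ah Yh T S
  have hpos : ∀ y ∈ Yh, 0 < 1 - ∑ j, h j * y j := fun y hy =>
    aux_pos d hd H horth hcolsum h y hy
  have hT : ∀ x ∈ Ah, T x ∈ Yh := by
    rintro x ⟨hx, hs⟩ i
    simp only [T]
    rw [aux_smul (fun j => H i j - h j) x, aux_sub]
    have hxi : 0 ≤ 1 + ∑ j, H i j * x j := hx i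
    have : 1 + (1 + ∑ j, h j * x j)⁻¹ * (∑ j, H i j * x j - ∑ j, h j * x j)
        = (1 + ∑ j, H i j * x j) / (1 + ∑ j, h j * x j) := by
      field_simp
      ring
    rw [this]
    positivity
  have hhS : ∀ y ∈ Yh, 1 + ∑ j, h j * S y j = (1 - ∑ j, h j * y j)⁻¹ := by
    intro y hy
    have hr := hpos y hy
    simp only [S]
    rw [aux_smul h y]
    field_simp
    ring
  have hS : ∀ y ∈ Yh, S y ∈ Ah := by
    intro y hy
    have hr := hpos y hy
    refine ⟨fun i => ?_, ?_⟩
    · have hyi := hy i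
      rw [aux_sub] at hyi
      simp only [S]
      rw [aux_smul (fun j => H i j) y]
      have : 1 + (1 - ∑ j, h j * y j)⁻¹ * ∑ j, H i j * y j
        = (1 + (∑ j, H i j * y j - ∑ j, h j * y j)) / (1 - ∑ j, h j * y j) := by
        field_simp
        ring
      rw [this]
      positivity
    · rw [hhS y hy]
      positivity
  have hST : ∀ x ∈ Ah, S (T x) = x := by
    rintro x ⟨hx, hs⟩
    have h1 : 1 - ∑ j, h j * T x j = (1 + ∑ j, h j * x j)⁻¹ := by
      simp only [T]
      rw [aux_smul h x]
      field_simp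
      ring
    change (1 - ∑ j, h j * T x j)⁻¹ • T x = x
    rw [h1, inv_inv]
    exact smul_inv_smul₀ hs.ne' x
  have hTS : ∀ y ∈ Yh, T (S y) = y := by
    intro y hy
    have hr := hpos y hy
    change (1 + ∑ j, h j * S y j)⁻¹ • S y = y
    rw [hhS y hy, inv_inv]
    exact smul_inv_smul₀ hr.ne' y
  refine ⟨Set.InvOn.bijOn ⟨hST, hTS⟩ hT hS, hST, hTS, hpos, ?_, ?_, ?_, ?_⟩
  · rintro _ ⟨y, hy, rfl⟩
    exact (hS y hy).1
  · rintro _ ⟨x, hx, rfl⟩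
    exact hT x hx
  · intro hi
    exact Set.Subset.antisymm (fun x hx => hx.1) fun x hx => ⟨hx, aux_interior d H h x hx hi⟩
  · intro hf
    exact aux_unbdd d hd H horth hcolsum h hf.2
end

section
/- Let ρ be an anchored law, let h be in the interior of ℋ := conv{γ_1,…,γ_d}, and let k ∈ ℋ. Define q_h as the measure with density x ↦ 1 + hᵀx with respect to ρ, and the fiber η_h := (T_h)_# q_h where T_h(x) := x/(1 + hᵀx). Then: (i) η_h has mean zero, ∫ y dη_h(y) = 0; (ii) the fibers are related by the transport formula η_k = (T_{k−h})_#((1 + (k−h)ᵀy) η_h(dy)), where T_{k−h}(y) := y/(1 + (k−h)ᵀy) is applied on the set {y : 1 + (k−h)ᵀy > 0}, on whose complement the weighted measure vanishes; (iii) η_h has bounded support. -/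
open Finset MeasureTheory
open scoped ENNReal

lemma hull_nonneg {d n : ℕ} (H : Matrix (Fin d) (Fin n) ℝ) (x : Fin n → ℝ)
    (hx : ∀ i, 0 ≤ 1 + ∑ j, H i j * x j) (v : Fin n → ℝ)
    (hv : v ∈ convexHull ℝ (Set.range fun i : Fin d => fun j => H i j)) :
    0 ≤ 1 + ∑ j, v j * x j := by
  have hc : Convex ℝ {v : Fin n → ℝ | 0 ≤ 1 + ∑ j, v j * x j} := by
    intro a ha b hb s t hs ht hst
    simp only [Set.mem_ofPred_eq] at *
    have : 1 + ∑ j, (s • a + t • b) j * x j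
        = s * (1 + ∑ j, a j * x j) + t * (1 + ∑ j, b j * x j) := by
      simp only [Pi.add_apply, Pi.smul_apply, smul_eq_mul, add_mul, Finset.sum_add_distrib,
        mul_add, Finset.mul_sum, mul_assoc]
      linarith
    rw [this]; positivity
  refine convexHull_min ?_ hc hv
  rintro _ ⟨i, rfl⟩
  exact hx i

lemma interior_bound {d n : ℕ} (H : Matrix (Fin d) (Fin n) ℝ) (h : Fin n → ℝ)
    (hh : h ∈ interior (convexHull ℝ (Set.range fun i : Fin d => fun j => H i j))) :
    ∃ δ > 0, ∀ x : Fin n → ℝ, (∀ i, 0 ≤ 1 + ∑ j, H i j * x j) →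
      ∀ l, δ * |x l| ≤ 1 + ∑ j, h j * x j := by
  obtain ⟨ε, hε, hb⟩ := Metric.mem_nhds_iff.1 (mem_interior_iff_mem_nhds.1 hh)
  refine ⟨ε / 2, by positivity, fun x hx l => ?_⟩
  have key : ∀ c : ℝ, |c| < ε → 0 ≤ 1 + ∑ j, h j * x j + c * x l := by
    intro c hc
    have h1 : h + Pi.single l c ∈ Metric.ball h ε := by
      simp [Metric.mem_ball, dist_eq_norm, Pi.norm_single, hc]
    have h2 := hull_nonneg H x hx _ (hb h1)
    simp only [Pi.add_apply, add_mul, Finset.sum_add_distrib, Pi.single_apply, ite_mul,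
      zero_mul, Finset.sum_ite_eq', Finset.mem_univ, if_true] at h2
    linarith
  have a := key (ε / 2) (by rw [abs_of_pos] <;> linarith)
  have b := key (-(ε / 2)) (by rw [abs_neg, abs_of_pos] <;> linarith)
  rcases abs_cases (x l) with ⟨h1, _⟩ | ⟨h1, _⟩ <;> rw [h1] <;> linarith

lemma lintegral_map_withDensity {X : Type*} [MeasurableSpace X] (μ : Measure X) (w : X → ℝ≥0∞)
    (T : X → X) (f : X → ℝ≥0∞) (hw : Measurable w) (hT : Measurable T) (hf : Measurable f) :
    ∫⁻ x, f x ∂((μ.withDensity w).map T) = ∫⁻ x, w x * f (T x) ∂μ := by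
  rw [lintegral_map hf hT]
  exact lintegral_withDensity_eq_lintegral_mul _ hw (hf.comp hT)

/-- Let `ρ` be an anchored law, `h` in the interior of
`ℋ = conv{γ₁,…,γ_d}`, `k ∈ ℋ`.  With `q_v := (1 + vᵀx) ρ(dx)`,
`T_v(x) := x/(1 + vᵀx)` and the projective fiber `η_v := (T_v)_# q_v`:
(i) `η_h` has mean zero; (ii) `η_k = (T_{k-h})_# ((1 + (k-h)ᵀy) η_h(dy))`
(the map being applied where `1 + (k-h)ᵀy > 0`, the weighted measure vanishing on the
complement); (iii) `η_h` has bounded support. -/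
theorem stmt4 (d : ℕ) (hd : 2 ≤ d)
    (H : Matrix (Fin d) (Fin (d - 1)) ℝ)
    (horth : H.transpose * H = 1)
    (hcolsum : ∀ j, ∑ i, H i j = 0)
    (ρ : Measure (Fin (d - 1) → ℝ)) [IsProbabilityMeasure ρ]
    (hsupp : ρ {x | ∀ i, 0 ≤ 1 + ∑ j, H i j * x j}ᶜ = 0)
    (hmean : ∫ x, x ∂ρ = 0)
    (h k : Fin (d - 1) → ℝ)
    (hh : h ∈ interior (convexHull ℝ (Set.range fun i : Fin d => fun j => H i j)))
    (hk : k ∈ convexHull ℝ (Set.range fun i : Fin d => fun j => H i j)) :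
    let T : (Fin (d - 1) → ℝ) → (Fin (d - 1) → ℝ) → (Fin (d - 1) → ℝ) :=
      fun v x => (1 + ∑ j, v j * x j)⁻¹ • x
    let q : (Fin (d - 1) → ℝ) → Measure (Fin (d - 1) → ℝ) :=
      fun v => ρ.withDensity fun x => ENNReal.ofReal (1 + ∑ j, v j * x j)
    let η : (Fin (d - 1) → ℝ) → Measure (Fin (d - 1) → ℝ) := fun v => (q v).map (T v)
    (∫ y, y ∂(η h) = 0) ∧
    (η k = ((η h).withDensity fun y =>
        ENNReal.ofReal (1 + ∑ j, (k j - h j) * y j)).map (T (k - h))) ∧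
    (∃ s : Set (Fin (d - 1) → ℝ), Bornology.IsBounded s ∧ η h sᶜ = 0) := by
  intro T q η
  obtain ⟨δ, hδ, hb⟩ := interior_bound H h hh
  have hpos : ∀ x : Fin (d - 1) → ℝ, (∀ i, 0 ≤ 1 + ∑ j, H i j * x j) →
      0 < 1 + ∑ j, h j * x j := by
    intro x hx
    by_cases h0 : ∃ l, x l ≠ 0
    · obtain ⟨l, hl⟩ := h0
      have := abs_pos.2 hl
      exact lt_of_lt_of_le (by positivity) (hb x hx l)
    · push Not at h0
      simp [h0]
  have hae : ∀ᵐ x ∂ρ, ∀ i, 0 ≤ 1 + ∑ j, H i j * x j := by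
    rw [ae_iff]; exact hsupp
  have hw : ∀ v : Fin (d - 1) → ℝ, Measurable fun x : Fin (d - 1) → ℝ =>
      1 + ∑ j, v j * x j := by
    intro v; fun_prop
  have hwo : ∀ v : Fin (d - 1) → ℝ, Measurable fun x : Fin (d - 1) → ℝ =>
      ENNReal.ofReal (1 + ∑ j, v j * x j) := fun v => (hw v).ennreal_ofReal
  have hT : ∀ v, Measurable (T v) := fun v => (hw v).inv.smul measurable_id
  refine ⟨?_, ?_, ?_⟩
  · simp only [η, q]
    rw [integral_map (hT h).aemeasurable (by fun_prop),
      integral_withDensity_eq_integral_toReal_smul (hwo h) (by simp), ← hmean]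
    refine integral_congr_ae ?_
    filter_upwards [hae] with x hx
    have hp := hpos x hx
    rw [ENNReal.toReal_ofReal hp.le]
    simp only [T]
    rw [smul_smul, mul_inv_cancel₀ hp.ne', one_smul]
  · refine Measure.ext_of_lintegral _ fun f hf => ?_
    have hw2 : Measurable fun y : Fin (d - 1) → ℝ =>
        ENNReal.ofReal (1 + ∑ j, (k j - h j) * y j) := hwo (k - h)
    have hg := hf.comp (hT (k - h))
    simp only [η, q]
    rw [lintegral_map_withDensity ρ _ _ f (hwo k) (hT k) hf,
      lintegral_map_withDensity _ _ _ f hw2 (hT (k - h)) hf]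
    refine Eq.trans ?_ (lintegral_map_withDensity ρ _ _ _ (hwo h) (hT h) (hw2.mul hg)).symm
    refine lintegral_congr_ae ?_
    filter_upwards [hae] with x hx
    have hp := hpos x hx
    have e1 : 1 + ∑ j, (k j - h j) * T h x j
        = (1 + ∑ j, h j * x j)⁻¹ * (1 + ∑ j, k j * x j) := by
      have : ∑ j, (k j - h j) * T h x j
          = (1 + ∑ j, h j * x j)⁻¹ * (∑ j, k j * x j - ∑ j, h j * x j) := by
        rw [← Finset.sum_sub_distrib, Finset.mul_sum]
        refine Finset.sum_congr rfl fun j _ => ?_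
        simp only [T, Pi.smul_apply, smul_eq_mul]
        ring
      rw [this]
      field_simp
      ring
    have e2 : T (k - h) (T h x) = T k x := by
      have : T (k - h) (T h x) = (1 + ∑ j, (k j - h j) * T h x j)⁻¹ • T h x := rfl
      rw [this, e1]
      simp only [T]
      rw [smul_smul, mul_inv, inv_inv]
      congr 1
      field_simp
    simp only [Pi.mul_apply, Function.comp_apply]
    rw [e2, e1, ← mul_assoc, ← ENNReal.ofReal_mul hp.le, ← mul_assoc, mul_inv_cancel₀ hp.ne',
      one_mul]
  · refine ⟨Metric.closedBall 0 δ⁻¹, Metric.isBounded_closedBall, ?_⟩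
    have hms : MeasurableSet (Metric.closedBall (0 : Fin (d - 1) → ℝ) δ⁻¹)ᶜ :=
      Metric.isClosed_closedBall.measurableSet.compl
    simp only [η, q]
    rw [Measure.map_apply (hT h) hms]
    refine withDensity_absolutelyContinuous _ _ ?_
    refine measure_mono_null ?_ hsupp
    intro x hx hx2
    apply hx
    have hp := hpos x hx2
    rw [mem_closedBall_zero_iff, pi_norm_le_iff_of_nonneg (by positivity)]
    intro l
    have := hb x hx2 l
    simp only [T, Pi.smul_apply, smul_eq_mul, Real.norm_eq_abs]
    rw [abs_mul, abs_inv, abs_of_pos hp, inv_mul_le_iff₀ hp, ← div_eq_mul_inv, le_div_iff₀ hδ]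
    linarith
end

section
/- Let μ and ν be Borel probability measures on ℝ with compact support and the same mean, and suppose that ∫ φ dμ ≤ ∫ φ dν for every convex function φ : ℝ → ℝ. Then for every n ≥ 1 and every convex function φ : ℝ → ℝ, ∫_{ℝ^n} φ((1/n)∑_{m=1}^n z_m) dμ^{⊗n}(z) ≤ ∫_{ℝ^n} φ((1/n)∑_{m=1}^n z_m) dν^{⊗n}(z); that is, convex order between compactly supported laws with equal means is preserved by i.i.d. averaging. -/
open Finset MeasureTheory

lemma pi_integrable (μ : Measure ℝ) [IsProbabilityMeasure μ]
    (hμc : ∃ s : Set ℝ, IsCompact s ∧ μ sᶜ = 0) (n : ℕ) (f : (Fin n → ℝ) → ℝ)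
    (hf : Continuous f) : Integrable f (Measure.pi fun _ : Fin n => μ) := by
  obtain ⟨s, hs, h0⟩ := hμc
  have hK : IsCompact (Set.pi Set.univ (fun _ : Fin n => s)) := isCompact_univ_pi fun _ => hs
  have hae : ∀ᵐ z ∂(Measure.pi fun _ : Fin n => μ), z ∈ Set.pi Set.univ (fun _ : Fin n => s) := by
    have : ∀ i : Fin n, ∀ᵐ z ∂(Measure.pi fun _ : Fin n => μ), z i ∈ s := fun i =>
      (measurePreserving_eval (fun _ : Fin n => μ) i).quasiMeasurePreserving.ae
        (p := fun x => x ∈ s) h0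
    filter_upwards [ae_all_iff.2 this] with z hz
    exact fun i _ => hz i
  have := hf.continuousOn.integrableOn_compact (μ := Measure.pi fun _ : Fin n => μ) hK
  rwa [IntegrableOn, Measure.restrict_eq_self_of_ae_mem hae] at this

lemma integrable_one (μ : Measure ℝ) [IsProbabilityMeasure μ]
    (hμc : ∃ s : Set ℝ, IsCompact s ∧ μ sᶜ = 0) (f : ℝ → ℝ)
    (hf : Continuous f) : Integrable f μ := by
  obtain ⟨s, hs, h0⟩ := hμc
  have := hf.continuousOn.integrableOn_compact (μ := μ) hs
  rwa [IntegrableOn, Measure.restrict_eq_self_of_ae_mem (s := s) h0] at this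

lemma convex_cont {φ : ℝ → ℝ} (hφ : ConvexOn ℝ Set.univ φ) : Continuous φ :=
  continuousOn_univ.1 (hφ.continuousOn isOpen_univ)

lemma convex_shift {φ : ℝ → ℝ} (hφ : ConvexOn ℝ Set.univ φ) (c : ℝ) :
    ConvexOn ℝ Set.univ (fun x => φ (c + x)) := by
  refine ⟨convex_univ, fun x _ y _ a b ha hb hab => ?_⟩
  have := hφ.2 (Set.mem_univ (c + x)) (Set.mem_univ (c + y)) ha hb hab
  have e : a • (c + x) + b • (c + y) = c + (a • x + b • y) := by
    simp only [smul_eq_mul]; linear_combination c * hab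
  rwa [e] at this

lemma convex_integral (ν : Measure ℝ) [IsProbabilityMeasure ν]
    (hνc : ∃ s : Set ℝ, IsCompact s ∧ ν sᶜ = 0) (n : ℕ) {φ : ℝ → ℝ}
    (hφ : ConvexOn ℝ Set.univ φ) :
    ConvexOn ℝ Set.univ (fun x => ∫ z, φ (x + ∑ m, z m) ∂(Measure.pi fun _ : Fin n => ν)) := by
  have hc := convex_cont hφ
  have hi : ∀ x, Integrable (fun z : Fin n → ℝ => φ (x + ∑ m, z m))
      (Measure.pi fun _ : Fin n => ν) := fun x => pi_integrable ν hνc n _ (by fun_prop)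
  refine ⟨convex_univ, fun x _ y _ a b ha hb hab => ?_⟩
  simp only [smul_eq_mul]
  rw [← integral_const_mul, ← integral_const_mul,
    ← integral_add ((hi x).const_mul a) ((hi y).const_mul b)]
  refine integral_mono (hi _) (((hi x).const_mul a).add ((hi y).const_mul b)) fun z => ?_
  have := (convex_shift hφ (∑ m, z m)).2 (Set.mem_univ x) (Set.mem_univ y) ha hb hab
  simpa [add_comm] using this

lemma integral_succ (μ : Measure ℝ) [IsProbabilityMeasure μ]
    (hμc : ∃ s : Set ℝ, IsCompact s ∧ μ sᶜ = 0) (n : ℕ) {φ : ℝ → ℝ} (hφ : Continuous φ) :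
    Integrable (fun x => ∫ z, φ (x + ∑ m, z m) ∂(Measure.pi fun _ : Fin n => μ)) μ ∧
    ∫ z, φ (∑ m, z m) ∂(Measure.pi fun _ : Fin (n + 1) => μ) =
      ∫ x, ∫ z, φ (x + ∑ m, z m) ∂(Measure.pi fun _ : Fin n => μ) ∂μ := by
  have mp := measurePreserving_piFinSuccAbove (fun _ : Fin (n + 1) => μ) 0
  have key : ∀ z : Fin (n + 1) → ℝ, φ (∑ m, z m) =
      (fun p : ℝ × (Fin n → ℝ) => φ (p.1 + ∑ m, p.2 m))
        (MeasurableEquiv.piFinSuccAbove (fun _ => ℝ) 0 z) := by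
    intro z
    simp [Fin.sum_univ_succ, MeasurableEquiv.piFinSuccAbove, Fin.tail]
  have hint : Integrable (fun p : ℝ × (Fin n → ℝ) => φ (p.1 + ∑ m, p.2 m))
      (μ.prod (Measure.pi fun _ : Fin n => μ)) := by
    rw [← mp.integrable_comp_emb (MeasurableEquiv.measurableEmbedding _)]
    refine (pi_integrable μ hμc (n + 1) (fun z => φ (∑ m, z m)) (by fun_prop)).congr ?_
    exact Filter.Eventually.of_forall key
  refine ⟨hint.integral_prod_left, ?_⟩
  rw [← integral_prod _ hint, ← mp.integral_comp (MeasurableEquiv.measurableEmbedding _)]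
  exact integral_congr_ae (Filter.Eventually.of_forall key)

lemma sum_order (μ ν : Measure ℝ) [IsProbabilityMeasure μ] [IsProbabilityMeasure ν]
    (hμc : ∃ s : Set ℝ, IsCompact s ∧ μ sᶜ = 0)
    (hνc : ∃ s : Set ℝ, IsCompact s ∧ ν sᶜ = 0)
    (hcx : ∀ φ : ℝ → ℝ, ConvexOn ℝ Set.univ φ → ∫ z, φ z ∂μ ≤ ∫ z, φ z ∂ν)
    (n : ℕ) : ∀ (φ : ℝ → ℝ), ConvexOn ℝ Set.univ φ →
    ∫ z, φ (∑ m, z m) ∂(Measure.pi fun _ : Fin n => μ) ≤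
      ∫ z, φ (∑ m, z m) ∂(Measure.pi fun _ : Fin n => ν) := by
  induction n with
  | zero => intro φ _; simp
  | succ n ih =>
    intro φ hφ
    have hG := convex_integral ν hνc n hφ
    obtain ⟨h1, e1⟩ := integral_succ μ hμc n (convex_cont hφ)
    rw [e1, (integral_succ ν hνc n (convex_cont hφ)).2]
    refine le_trans ?_ (hcx _ hG)
    exact integral_mono h1 (integrable_one μ hμc _ (convex_cont hG))
      fun x => ih _ (convex_shift hφ x)

/-- Let `μ, ν` be compactly supported Borel probability measures on `ℝ`
with the same mean, and suppose `∫ φ dμ ≤ ∫ φ dν` for every convex `φ : ℝ → ℝ`.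
Then for every `n ≥ 1` and every convex `φ : ℝ → ℝ`,
`∫ φ((1/n)∑ₘ zₘ) dμ^{⊗n}(z) ≤ ∫ φ((1/n)∑ₘ zₘ) dν^{⊗n}(z)`:
convex order between compactly supported laws with equal means is preserved by
i.i.d. averaging. -/
theorem stmt8 (μ ν : Measure ℝ) [IsProbabilityMeasure μ] [IsProbabilityMeasure ν]
    (hμc : ∃ s : Set ℝ, IsCompact s ∧ μ sᶜ = 0)
    (hνc : ∃ s : Set ℝ, IsCompact s ∧ ν sᶜ = 0)
    (hmean : ∫ z, z ∂μ = ∫ z, z ∂ν)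
    (hcx : ∀ φ : ℝ → ℝ, ConvexOn ℝ Set.univ φ → ∫ z, φ z ∂μ ≤ ∫ z, φ z ∂ν)
    (n : ℕ) (hn : 1 ≤ n) (φ : ℝ → ℝ) (hφ : ConvexOn ℝ Set.univ φ) :
    ∫ z, φ ((∑ m, z m) / n) ∂(Measure.pi fun _ : Fin n => μ) ≤
      ∫ z, φ ((∑ m, z m) / n) ∂(Measure.pi fun _ : Fin n => ν) := by

  refine sum_order μ ν hμc hνc hcx n (fun x => φ (x / n)) ⟨convex_univ, ?_⟩
  intro x _ y _ a b ha hb hab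
  have := hφ.2 (Set.mem_univ (x / n)) (Set.mem_univ (y / n)) ha hb hab
  have e : a • (x / (n : ℝ)) + b • (y / (n : ℝ)) = (a • x + b • y) / n := by
    simp only [smul_eq_mul]; ring
  rwa [e] at this
end

section
/- Fix ε₀ > 0 and set a := e^{−ε₀}, b := e^{ε₀}. Let μ be any Borel probability measure on [a,b] with ∫ z dμ(z) = 1, and let μ* := ((b−1)/(b−a)) δ_a + ((1−a)/(b−a)) δ_b be the endpoint two-point law with mean 1. Then for every n ≥ 1 and every convex function f : [a,b] → ℝ, ∫_{[a,b]^n} f((1/n)∑_{m=1}^n z_m) dμ^{⊗n}(z) ≤ ∫_{[a,b]^n} f((1/n)∑_{m=1}^n z_m) d(μ*)^{⊗n}(z). In particular, taking f(t) = (t−α)₊ and f(t) = (1−αt)₊ for α ≥ 1, both directed hockey-stick profiles of the n-fold averaged law are maximized by μ*. -/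
open Finset MeasureTheory
open scoped ENNReal

/-- The endpoint two-point law `μ* = ((b-1)/(b-a)) δ_a + ((1-a)/(b-a)) δ_b`. -/
noncomputable def muStar (a b : ℝ) : Measure ℝ :=
  ((b - 1) / (b - a)).toNNReal • Measure.dirac a + ((1 - a) / (b - a)).toNNReal • Measure.dirac b

instance muStar_finite (a b : ℝ) : IsFiniteMeasure (muStar a b) := by
  unfold muStar; infer_instance

lemma aux_meas {a b : ℝ} {f : ℝ → ℝ} (hf : ConvexOn ℝ (Set.Icc a b) f) :
    Measurable ((Set.Icc a b).indicator f) := by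
  have hc : ContinuousOn f (Set.Ioo a b) := by
    have := hf.continuousOn_interior
    rwa [interior_Icc] at this
  have h1 : Measurable ((Set.Ioo a b).indicator f) := by
    have h2 := (continuous_const (y := (0 : ℝ))).continuousOn (s := (Set.Ioo a b)ᶜ)
    classical
    rw [← Set.piecewise_eq_indicator]
    exact hc.measurable_piecewise h2 measurableSet_Ioo
  refine Measurable.measurable_of_countable_ne h1 ?_
  refine Set.Countable.mono ?_ (Set.toFinite {a, b}).countable
  intro x hx
  by_contra hx'
  simp only [Set.mem_insert_iff, Set.mem_singleton_iff, not_or] at hx'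
  apply hx
  by_cases h : x ∈ Set.Ioo a b
  · rw [Set.indicator_of_mem h, Set.indicator_of_mem (Set.Ioo_subset_Icc_self h)]
  · rw [Set.indicator_of_notMem h, Set.indicator_of_notMem]
    exact fun h' => h ⟨lt_of_le_of_ne h'.1 (Ne.symm hx'.1), lt_of_le_of_ne h'.2 hx'.2⟩

lemma aux_bdd {a b : ℝ} {f : ℝ → ℝ} (hf : ConvexOn ℝ (Set.Icc a b) f) :
    ∃ C, ∀ x, |(Set.Icc a b).indicator f x| ≤ C := by
  refine ⟨max (|f a|) (|f b|) + 2 * |f ((a + b) / 2)|, fun x => ?_⟩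
  have hm : |f a| ≤ max (|f a|) (|f b|) := le_max_left _ _
  have hm' : |f b| ≤ max (|f a|) (|f b|) := le_max_right _ _
  have p1 := abs_nonneg (f a)
  have p2 := abs_nonneg (f ((a + b) / 2))
  by_cases hx : x ∈ Set.Icc a b
  · rw [Set.indicator_of_mem hx]
    have hab : a ≤ b := hx.1.trans hx.2
    have key : ∀ y ∈ Set.Icc a b, f y ≤ max (|f a|) (|f b|) := fun y hy =>
      (hf.le_max_of_mem_Icc (Set.left_mem_Icc.2 hab) (Set.right_mem_Icc.2 hab) hy).trans
        (max_le_max (le_abs_self _) (le_abs_self _))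
    have hy : a + b - x ∈ Set.Icc a b := ⟨by linarith [hx.2], by linarith [hx.1]⟩
    have h1 := key x hx
    have h2 := key _ hy
    have h3 := hf.2 hx hy (show (0 : ℝ) ≤ 1 / 2 by norm_num)
      (show (0 : ℝ) ≤ 1 / 2 by norm_num) (by norm_num)
    simp only [smul_eq_mul] at h3
    rw [show 1 / 2 * x + 1 / 2 * (a + b - x) = (a + b) / 2 by ring] at h3
    have h4 := neg_abs_le (f ((a + b) / 2))
    rw [abs_le]
    constructor <;> linarith
  · rw [Set.indicator_of_notMem hx, abs_zero]
    linarith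

lemma aux_int_star {a b : ℝ} (ha : a < 1) (hb : 1 < b) (H : ℝ → ℝ) :
    ∫ z, H z ∂(muStar a b) = (b - 1) / (b - a) * H a + (1 - a) / (b - a) * H b := by
  have h1 : 0 ≤ (b - 1) / (b - a) := div_nonneg (by linarith) (by linarith)
  have h2 : 0 ≤ (1 - a) / (b - a) := div_nonneg (by linarith) (by linarith)
  unfold muStar
  have i1 : ∀ (c : NNReal) (x : ℝ), Integrable H (c • Measure.dirac x) := fun c x =>
    (integrable_dirac (by simp)).smul_measure_nnreal
  rw [integral_add_measure (i1 _ _) (i1 _ _), integral_smul_nnreal_measure,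
    integral_smul_nnreal_measure, integral_dirac, integral_dirac]
  simp [NNReal.smul_def, h1, h2]

lemma aux_prob {a b : ℝ} (ha : a < 1) (hb : 1 < b) : IsProbabilityMeasure (muStar a b) := by
  have h := aux_int_star ha hb (fun _ => 1)
  constructor
  have h3 : (b - 1) / (b - a) * 1 + (1 - a) / (b - a) * 1 = 1 := by
    have : b - a ≠ 0 := by linarith
    field_simp
    ring
  rw [h3] at h
  simp only [integral_const, smul_eq_mul, mul_one] at h
  rw [measureReal_def] at h
  rw [← ENNReal.ofReal_toReal (measure_ne_top (muStar a b) Set.univ), h, ENNReal.ofReal_one]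

lemma aux_supp (a b : ℝ) (hab : a ≤ b) : muStar a b (Set.Icc a b)ᶜ = 0 := by
  unfold muStar
  simp [hab]

lemma aux_ae {a b : ℝ} {μ : Measure ℝ} [IsProbabilityMeasure μ]
    (hs : μ (Set.Icc a b)ᶜ = 0) (n : ℕ) :
    ∀ᵐ z ∂(Measure.pi fun _ : Fin n => μ), (∑ m, z m) ∈ Set.Icc (n * a) (n * b) := by
  have h : ∀ m : Fin n, ∀ᵐ z ∂(Measure.pi fun _ : Fin n => μ), z m ∈ Set.Icc a b := fun m =>
    (Measure.tendsto_eval_ae_ae (μ := fun _ : Fin n => μ) (i := m)).eventually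
      (show ∀ᵐ x ∂μ, x ∈ Set.Icc a b from hs)
  filter_upwards [ae_all_iff.2 h] with z hz
  constructor
  · simpa using Finset.card_nsmul_le_sum Finset.univ z a fun i _ => (hz i).1
  · simpa using Finset.sum_le_card_nsmul Finset.univ z b fun i _ => (hz i).2

lemma aux_one {a b : ℝ} (ha : a < 1) (hb : 1 < b) {μ : Measure ℝ} [IsProbabilityMeasure μ]
    (hs : μ (Set.Icc a b)ᶜ = 0) (hmean : ∫ z, z ∂μ = 1) {H : ℝ → ℝ}
    (hH : ConvexOn ℝ (Set.Icc a b) H) (hi : Integrable H μ) :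
    ∫ z, H z ∂μ ≤ ∫ z, H z ∂(muStar a b) := by
  rw [aux_int_star ha hb]
  have hid : Integrable (fun z : ℝ => z) μ := by
    by_contra h
    rw [integral_undef h] at hmean
    norm_num at hmean
  have hba : 0 < b - a := by linarith
  have hle : ∫ z, H z ∂μ ≤ ∫ z, ((b * H a - a * H b) / (b - a) + (H b - H a) / (b - a) * z) ∂μ := by
    refine integral_mono_ae hi ((integrable_const _).add (hid.const_mul _)) ?_
    filter_upwards [show ∀ᵐ x ∂μ, x ∈ Set.Icc a b from hs] with z hz
    have := hH.2 (Set.left_mem_Icc.2 (by linarith : a ≤ b)) (Set.right_mem_Icc.2 (by linarith))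
      (show 0 ≤ (b - z) / (b - a) from div_nonneg (by linarith [hz.2]) hba.le)
      (show 0 ≤ (z - a) / (b - a) from div_nonneg (by linarith [hz.1]) hba.le)
      (by field_simp; ring)
    simp only [smul_eq_mul] at this
    rw [show (b - z) / (b - a) * a + (z - a) / (b - a) * b = z by field_simp; ring] at this
    refine this.trans (le_of_eq ?_)
    field_simp
    ring
  refine hle.trans (le_of_eq ?_)
  rw [integral_add (integrable_const _) (hid.const_mul _), integral_const_mul, hmean]
  simp
  field_simp
  ring

lemma aux_split {ν : Measure ℝ} [IsProbabilityMeasure ν] (n : ℕ) {G : ℝ → ℝ}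
    (hG : Measurable G) {C : ℝ} (hC : ∀ x, |G x| ≤ C) :
    ∫ z, G (∑ m, z m) ∂(Measure.pi fun _ : Fin (n + 1) => ν) =
      ∫ x, ∫ z, G (x + ∑ m, z m) ∂(Measure.pi fun _ : Fin n => ν) ∂ν := by
  have hp := (measurePreserving_piFinSuccAbove (fun _ : Fin (n + 1) => ν) 0)
  have e := hp.integral_comp (MeasurableEquiv.measurableEmbedding _)
    (fun p : ℝ × (Fin n → ℝ) => G (p.1 + ∑ m, p.2 m))
  have hm : Measurable (fun p : ℝ × (Fin n → ℝ) => G (p.1 + ∑ m, p.2 m)) :=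
    hG.comp (by fun_prop)
  rw [← integral_prod (fun p : ℝ × (Fin n → ℝ) => G (p.1 + ∑ m, p.2 m))
    (Integrable.of_bound hm.aestronglyMeasurable C (Filter.Eventually.of_forall fun p => hC _))]
  rw [← e]
  congr 1
  ext z
  simp [Fin.sum_univ_succ, Fin.removeNth, Fin.tail, MeasurableEquiv.piFinSuccAbove]

lemma aux_main {a b : ℝ} (ha : a < 1) (hb : 1 < b) {μ : Measure ℝ} [IsProbabilityMeasure μ]
    (hs : μ (Set.Icc a b)ᶜ = 0) (hmean : ∫ z, z ∂μ = 1) (n : ℕ) :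
    ∀ {G : ℝ → ℝ} (_ : Measurable G) {C : ℝ} (_ : ∀ x, |G x| ≤ C)
      (_ : ConvexOn ℝ (Set.Icc (n * a) (n * b)) G),
    ∫ z, G (∑ m, z m) ∂(Measure.pi fun _ : Fin n => μ) ≤
      ∫ z, G (∑ m, z m) ∂(Measure.pi fun _ : Fin n => muStar a b) := by
  haveI := aux_prob ha hb
  induction n with
  | zero =>
    intro G _ C _ _
    rw [Measure.pi_of_empty, Measure.pi_of_empty]
  | succ n ih =>
    intro G hG C hC hconv
    rw [aux_split n hG hC, aux_split n hG hC]
    have hmem : ∀ x ∈ Set.Icc a b, ∀ s ∈ Set.Icc (n * a) (n * b),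
        x + s ∈ Set.Icc ((n + 1 : ℕ) * a) ((n + 1 : ℕ) * b) := by
      intro x hx s hs
      push_cast
      constructor
      · linarith [hx.1, hs.1]
      · linarith [hx.2, hs.2]
    have hii : ∀ (ν : Measure ℝ) [IsProbabilityMeasure ν] (x : ℝ),
        Integrable (fun z : Fin n → ℝ => G (x + ∑ m, z m)) (Measure.pi fun _ : Fin n => ν) := by
      intro ν _ x
      exact Integrable.of_bound (hG.comp (by fun_prop)).aestronglyMeasurable C
        (Filter.Eventually.of_forall fun p => hC _)
    have hio : ∀ (ν : Measure ℝ) [IsProbabilityMeasure ν],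
        Integrable (fun x => ∫ z, G (x + ∑ m, z m) ∂(Measure.pi fun _ : Fin n => ν)) μ := by
      intro ν _
      have hm : Measurable (fun p : ℝ × (Fin n → ℝ) => G (p.1 + ∑ m, p.2 m)) :=
        hG.comp (by fun_prop)
      exact (Integrable.of_bound (μ := μ.prod (Measure.pi fun _ : Fin n => ν))
        hm.aestronglyMeasurable C (Filter.Eventually.of_forall fun p => hC _)).integral_prod_left
    refine le_trans (integral_mono_ae (hio μ) (hio (muStar a b)) ?_)
      (aux_one ha hb hs hmean ?_ (hio (muStar a b)))
    · filter_upwards [show ∀ᵐ x ∂μ, x ∈ Set.Icc a b from hs] with x hx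
      refine ih (G := fun s => G (x + s)) (hG.comp (by fun_prop)) (fun s => hC _) ?_
      refine ⟨convex_Icc _ _, fun s hs t ht p q hp hq hpq => ?_⟩
      have := hconv.2 (hmem x hx s hs) (hmem x hx t ht) hp hq hpq
      simp only [smul_eq_mul] at this ⊢
      rwa [show p * (x + s) + q * (x + t) = x + (p * s + q * t) by
        linear_combination x * hpq] at this
    · refine ⟨convex_Icc _ _, fun x hx y hy p q hp hq hpq => ?_⟩
      simp only [smul_eq_mul]
      rw [← integral_const_mul, ← integral_const_mul,
        ← integral_add ((hii _ _).const_mul _) ((hii _ _).const_mul _)]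
      refine integral_mono_ae (hii _ _) (((hii _ _).const_mul _).add ((hii _ _).const_mul _)) ?_
      filter_upwards [aux_ae (aux_supp a b (by linarith)) n] with z hz
      have := hconv.2 (hmem x hx _ hz) (hmem y hy _ hz) hp hq hpq
      simp only [smul_eq_mul] at this
      rwa [show p * (x + ∑ m, z m) + q * (y + ∑ m, z m) = p * x + q * y + ∑ m, z m by
        linear_combination (∑ m, z m) * hpq] at this

lemma aux_final {a b : ℝ} (ha : a < 1) (hb : 1 < b) {μ : Measure ℝ} [IsProbabilityMeasure μ]
    (hs : μ (Set.Icc a b)ᶜ = 0) (hmean : ∫ z, z ∂μ = 1) (n : ℕ) (hn : 1 ≤ n)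
    (f : ℝ → ℝ) (hf : ConvexOn ℝ (Set.Icc a b) f) :
    ∫ z, f ((∑ m, z m) / n) ∂(Measure.pi fun _ : Fin n => μ) ≤
      ∫ z, f ((∑ m, z m) / n) ∂(Measure.pi fun _ : Fin n => muStar a b) := by
  haveI := aux_prob ha hb
  have hn0 : (0 : ℝ) < n := by exact_mod_cast hn
  have hmem : ∀ s ∈ Set.Icc (n * a) (n * b), s / n ∈ Set.Icc a b := by
    intro s hs
    constructor
    · rw [le_div_iff₀ hn0]; linarith [hs.1]
    · rw [div_le_iff₀ hn0]; linarith [hs.2]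
  obtain ⟨C, hC⟩ := aux_bdd hf
  have hm : Measurable (fun s : ℝ => (Set.Icc a b).indicator f (s / n)) :=
    (aux_meas hf).comp (by fun_prop)
  have key := aux_main ha hb hs hmean n hm (fun s => hC _) ?_
  · have he : ∀ (ν : Measure ℝ) [IsProbabilityMeasure ν], ν (Set.Icc a b)ᶜ = 0 →
        ∫ z, f ((∑ m, z m) / n) ∂(Measure.pi fun _ : Fin n => ν) =
        ∫ z, (Set.Icc a b).indicator f ((∑ m, z m) / n) ∂(Measure.pi fun _ : Fin n => ν) := by
      intro ν _ hν
      refine integral_congr_ae ?_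
      filter_upwards [aux_ae hν n] with z hz
      rw [Set.indicator_of_mem (hmem _ hz)]
    rw [he μ hs, he _ (aux_supp a b (by linarith))]
    exact key
  · refine ⟨convex_Icc _ _, fun s hs t ht p q hp hq hpq => ?_⟩
    have h1 := hmem _ (convex_Icc _ _ hs ht hp hq hpq)
    simp only [Set.indicator_of_mem (hmem _ hs), Set.indicator_of_mem (hmem _ ht),
      Set.indicator_of_mem h1]
    have := hf.2 (hmem _ hs) (hmem _ ht) hp hq hpq
    simp only [smul_eq_mul] at this ⊢
    rwa [show p * (s / n) + q * (t / n) = (p * s + q * t) / n by ring] at this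

/-- Fix `ε₀ > 0`, `a := e^{-ε₀}`, `b := e^{ε₀}`.  Let `μ` be a Borel
probability measure on `[a,b]` with mean `1` and let `μ*` be the endpoint two-point
law with mean `1`.  Then for every `n ≥ 1` and every convex `f : [a,b] → ℝ`,
`∫ f((1/n)∑ zₘ) dμ^{⊗n} ≤ ∫ f((1/n)∑ zₘ) d(μ*)^{⊗n}`.  In particular both directed
hockey-stick profiles `f(t) = (t-α)₊` and `f(t) = (1-αt)₊`, `α ≥ 1`, of the averaged
law are maximized by `μ*`. -/
theorem stmt9 (ε₀ : ℝ) (hε : 0 < ε₀) (n : ℕ) (hn : 1 ≤ n)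
    (μ : Measure ℝ) [IsProbabilityMeasure μ]
    (hsupp : μ (Set.Icc (Real.exp (-ε₀)) (Real.exp ε₀))ᶜ = 0)
    (hmean : ∫ z, z ∂μ = 1) :
    let a := Real.exp (-ε₀)
    let b := Real.exp ε₀
    (∀ f : ℝ → ℝ, ConvexOn ℝ (Set.Icc a b) f →
      ∫ z, f ((∑ m, z m) / n) ∂(Measure.pi fun _ : Fin n => μ) ≤
        ∫ z, f ((∑ m, z m) / n) ∂(Measure.pi fun _ : Fin n => muStar a b)) ∧
    (∀ α : ℝ, 1 ≤ α →
      ∫ z, max ((∑ m, z m) / n - α) 0 ∂(Measure.pi fun _ : Fin n => μ) ≤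
        ∫ z, max ((∑ m, z m) / n - α) 0 ∂(Measure.pi fun _ : Fin n => muStar a b)) ∧
    (∀ α : ℝ, 1 ≤ α →
      ∫ z, max (1 - α * ((∑ m, z m) / n)) 0 ∂(Measure.pi fun _ : Fin n => μ) ≤
        ∫ z, max (1 - α * ((∑ m, z m) / n)) 0 ∂(Measure.pi fun _ : Fin n => muStar a b)) := by
  have ha : Real.exp (-ε₀) < 1 := by rw [Real.exp_lt_one_iff]; linarith
  have hb : 1 < Real.exp ε₀ := by rw [Real.one_lt_exp_iff]; exact hε
  intro a b
  have main := aux_final ha hb hsupp hmean n hn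
  have hid : ConvexOn ℝ (Set.Icc a b) (fun t : ℝ => t) := convexOn_id (convex_Icc _ _)
  refine ⟨main, fun α _ => main (fun t => max (t - α) 0) ?_,
    fun α _ => main (fun t => max (1 - α * t) 0) ?_⟩
  · refine ConvexOn.sup (f := fun t : ℝ => t - α) (g := fun _ => (0 : ℝ)) ?_
      (convexOn_const _ (convex_Icc _ _))
    refine ⟨convex_Icc _ _, fun s _ t _ p q _ _ hpq => le_of_eq ?_⟩
    simp only [smul_eq_mul]
    linear_combination α * hpq
  · refine ConvexOn.sup (f := fun t : ℝ => 1 - α * t) (g := fun _ => (0 : ℝ)) ?_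
      (convexOn_const _ (convex_Icc _ _))
    refine ⟨convex_Icc _ _, fun s _ t _ p q _ _ hpq => le_of_eq ?_⟩
    simp only [smul_eq_mul]
    linear_combination -hpq
end

section
/- Fix ε₀ > 0 and n ≥ 1, set a := e^{−ε₀}, b := e^{ε₀}, and let μ* := ((b−1)/(b−a)) δ_a + ((1−a)/(b−a)) δ_b. Let μ be a Borel probability measure on [a,b] with mean 1, let μ̄_n denote the pushforward of μ^{⊗n} under (z_1,…,z_n) ↦ (1/n)∑_m z_m, and define μ̄*_n analogously from μ*. If ∫ (t−α)₊ dμ̄_n(t) = ∫ (t−α)₊ dμ̄*_n(t) for every α ≥ 1 and ∫ (1−αt)₊ dμ̄_n(t) = ∫ (1−αt)₊ dμ̄*_n(t) for every α ≥ 1, then μ = μ*. -/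
open Finset MeasureTheory
open scoped ENNReal

open ProbabilityTheory

lemma aux_int_max (p q : ℝ) (hp : p ≤ 0) : ∫ u in p..q, max u 0 = (max q 0)^2/2 := by
  have hc : Continuous (fun u : ℝ => max u 0) := by fun_prop
  have h0 : ∀ r : ℝ, r ≤ 0 → ∫ u in r..0, max u 0 = 0 := by
    intro r hr
    rw [intervalIntegral.integral_congr (g := fun _ => (0:ℝ))]
    · simp
    · intro x hx
      rw [Set.uIcc_of_le hr] at hx
      exact max_eq_right hx.2
  rw [← intervalIntegral.integral_add_adjacent_intervals (hc.intervalIntegrable p 0)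
    (hc.intervalIntegrable 0 q), h0 p hp, zero_add]
  rcases le_total q 0 with h | h
  · rw [intervalIntegral.integral_symm, h0 q h, max_eq_right h]; simp
  · rw [intervalIntegral.integral_congr (g := fun u => u), integral_id, max_eq_left h]
    · ring
    · intro x hx
      rw [Set.uIcc_of_le h] at hx
      exact max_eq_left hx.1

lemma aux_sq (a b t : ℝ) (ht : t ∈ Set.Icc a b) :
    (t - 1)^2 = 2 * (∫ α in (1:ℝ)..b, max (t - α) 0) + 2 * ∫ s in a..(1:ℝ), max (s - t) 0 := by
  rw [intervalIntegral.integral_comp_sub_left (fun u => max u 0) t,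
    intervalIntegral.integral_comp_sub_right (fun u => max u 0) t,
    aux_int_max _ _ (by linarith [ht.2]), aux_int_max _ _ (by linarith [ht.1])]
  rcases le_total t 1 with h | h
  · rw [max_eq_right (by linarith), max_eq_left (by linarith)]; ring
  · rw [max_eq_left (by linarith), max_eq_right (by linarith)]; ring

lemma aux_integrable (a b : ℝ) (ν : Measure ℝ) [IsFiniteMeasure ν]
    (h : ν (Set.Icc a b)ᶜ = 0) (f : ℝ → ℝ) (hf : Continuous f) : Integrable f ν := by
  obtain ⟨C, hC⟩ := (isCompact_Icc (a := a) (b := b)).exists_bound_of_continuousOn hf.continuousOn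
  have h' : ∀ᵐ x ∂ν, x ∈ Set.Icc a b := h
  exact Integrable.of_bound hf.aestronglyMeasurable C (h'.mono hC)

lemma aux_swap (a b p q : ℝ) (hpq : p ≤ q) (ν : Measure ℝ) [IsFiniteMeasure ν]
    (h : ν (Set.Icc a b)ᶜ = 0) (f : ℝ → ℝ → ℝ) (hf : Continuous (Function.uncurry f))
    (hb : ∀ t s, |f t s| ≤ |t| + |s|) :
    Integrable (fun t => ∫ s in p..q, f t s) ν ∧
    ∫ t, (∫ s in p..q, f t s) ∂ν = ∫ s in p..q, (∫ t, f t s ∂ν) := by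
  have hI : Integrable (Function.uncurry f) (ν.prod (volume.restrict (Set.Ioc p q))) := by
    have h1 : Integrable (fun t : ℝ => |t|) ν := aux_integrable a b ν h _ continuous_abs
    have h2 : Integrable (fun t : ℝ => |t|) (volume.restrict (Set.Ioc p q)) :=
      (continuous_abs.integrableOn_Icc).mono_set Set.Ioc_subset_Icc_self
    refine Integrable.mono' ((h1.comp_fst _).add (h2.comp_snd ν)) hf.aestronglyMeasurable ?_
    exact Filter.Eventually.of_forall fun x => hb x.1 x.2
  simp only [intervalIntegral.integral_of_le hpq]
  exact ⟨hI.integral_prod_left, integral_integral_swap hI⟩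

lemma aux_second (a b : ℝ) (ha : 0 < a) (ha1 : a ≤ 1) (hb1 : 1 ≤ b) (ν : Measure ℝ)
    [IsFiniteMeasure ν] (h : ν (Set.Icc a b)ᶜ = 0) :
    ∫ t, (t-1)^2 ∂ν = 2 * (∫ α in (1:ℝ)..b, ∫ t, max (t - α) 0 ∂ν)
      + 2 * ∫ s in a..(1:ℝ), s * ∫ t, max (1 - s⁻¹ * t) 0 ∂ν := by
  have h' : ∀ᵐ x ∂ν, x ∈ Set.Icc a b := h
  have bd : ∀ x y : ℝ, |max (x - y) 0| ≤ |x| + |y| := by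
    intro x y
    rw [abs_of_nonneg (le_max_right _ _)]
    exact max_le (by linarith [le_abs_self x, neg_abs_le y]) (by positivity)
  obtain ⟨i1, e1⟩ := aux_swap a b 1 b hb1 ν h (fun t s => max (t - s) 0)
    (by unfold Function.uncurry; fun_prop) bd
  obtain ⟨i2, e2⟩ := aux_swap a b a 1 ha1 ν h (fun t s => max (s - t) 0)
    (by unfold Function.uncurry; fun_prop) (fun t s => by rw [add_comm]; exact bd s t)
  rw [integral_congr_ae (h'.mono fun t ht => aux_sq a b t ht), integral_add (i1.const_mul 2)
    (i2.const_mul 2), integral_const_mul, integral_const_mul, e1, e2]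
  congr 2
  refine intervalIntegral.integral_congr fun s hs => ?_
  rw [Set.uIcc_of_le ha1] at hs
  have hs0 : 0 < s := lt_of_lt_of_le ha hs.1
  beta_reduce
  rw [← integral_const_mul]
  congr 1; ext t
  rw [mul_max_of_nonneg _ _ hs0.le, mul_zero]
  congr 1; field_simp

lemma aux_rigid (a b : ℝ) (hab : a < b) (ν : Measure ℝ) [IsProbabilityMeasure ν]
    (h : ν (Set.Icc a b)ᶜ = 0) (hm : ∫ z, z ∂ν = 1)
    (hv : ∫ z, (z-1)^2 ∂ν = (b-1)*(1-a)) (s : Set ℝ) (hs : MeasurableSet s) :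
    ν.real s = (s.indicator 1 a * (b - 1) + s.indicator 1 b * (1 - a)) / (b - a) := by
  have h' : ∀ᵐ x ∂ν, x ∈ Set.Icc a b := h
  have I := aux_integrable a b ν h
  have key : ∫ t, (b-t)*(t-a) ∂ν = 0 := by
    have : (fun t : ℝ => (b-t)*(t-a)) = fun t => ((a+b-2)*t + ((1-a*b))) - (t-1)^2 := by
      ext t; ring
    rw [this, integral_sub (I _ (by fun_prop)) (I _ (by fun_prop)),
      integral_add (I _ (by fun_prop)) (I _ (by fun_prop)), integral_const_mul, hm, hv]
    simp; ring
  rw [integral_eq_zero_iff_of_nonneg_ae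
    (h'.mono fun t ht => mul_nonneg (by linarith [ht.2]) (by linarith [ht.1]))
    (I _ (by fun_prop))] at key
  have hba : b - a ≠ 0 := by linarith
  rw [← integral_indicator_one hs]
  have : ∀ᵐ t ∂ν, s.indicator (1 : ℝ → ℝ) t =
      (s.indicator 1 a * (b - t) + s.indicator 1 b * (t - a)) / (b - a) := by
    filter_upwards [key] with t ht
    rcases mul_eq_zero.1 ht with h | h
    · have : t = b := by linarith
      subst this; field_simp; ring
    · have : t = a := by linarith
      subst this; field_simp; ring
  rw [integral_congr_ae this, integral_div, integral_add (I _ (by fun_prop)) (I _ (by fun_prop)),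
    integral_const_mul, integral_const_mul, integral_sub (I _ (by fun_prop)) (I _ (by fun_prop)),
    integral_sub (I _ (by fun_prop)) (I _ (by fun_prop)), hm]
  simp

lemma aux_bar (a b : ℝ) (n : ℕ) (hn : 1 ≤ n) (ν : Measure ℝ) [IsProbabilityMeasure ν]
    (h : ν (Set.Icc a b)ᶜ = 0) (hm : ∫ z, z ∂ν = 1) (ρ : Measure ℝ)
    (hρ : ρ = (Measure.pi fun _ : Fin n => ν).map (fun z : Fin n → ℝ => (∑ m, z m) / (n : ℝ))) :
    IsProbabilityMeasure ρ ∧ ρ (Set.Icc a b)ᶜ = 0 ∧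
      ∫ t, (t-1)^2 ∂ρ = (∫ z, (z-1)^2 ∂ν) / (n : ℝ) := by
  have hn0 : (0:ℝ) < n := by exact_mod_cast hn
  have hmeas : Measurable (fun z : Fin n → ℝ => (∑ m, z m) / (n:ℝ)) := by fun_prop
  have h' : ∀ᵐ x ∂ν, x ∈ Set.Icc a b := h
  have I := aux_integrable a b ν h
  have mp : ∀ i : Fin n, MeasurePreserving (Function.eval i) (Measure.pi fun _ : Fin n => ν) ν :=
    fun i => measurePreserving_eval (fun _ : Fin n => ν) i
  refine ⟨?_, ?_, ?_⟩
  · rw [hρ]; exact Measure.isProbabilityMeasure_map hmeas.aemeasurable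
  · have hae : ∀ᵐ z ∂(Measure.pi fun _ : Fin n => ν), ∀ i, z i ∈ Set.Icc a b := by
      rw [ae_all_iff]
      intro i
      exact (mp i).quasiMeasurePreserving.ae h'
    have : ∀ᵐ x ∂ρ, x ∈ Set.Icc a b := by
      rw [hρ]
      refine (ae_map_iff (p := fun x => x ∈ Set.Icc a b) hmeas.aemeasurable measurableSet_Icc).2 ?_
      filter_upwards [hae] with z hz
      constructor
      · rw [le_div_iff₀ hn0]
        have := Finset.card_nsmul_le_sum Finset.univ z a (fun i _ => (hz i).1)
        simp at this; linarith
      · rw [div_le_iff₀ hn0]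
        have := Finset.sum_le_card_nsmul Finset.univ z b (fun i _ => (hz i).2)
        simp at this; linarith
    exact this
  · set P := Measure.pi fun _ : Fin n => ν
    have hL : MemLp (id : ℝ → ℝ) 2 ν :=
      (memLp_two_iff_integrable_sq aestronglyMeasurable_id).2 (I _ (by fun_prop))
    have hLi : ∀ i : Fin n, MemLp (fun z : Fin n → ℝ => z i) 2 P := fun i =>
      hL.comp_measurePreserving (mp i)
    have hE : ∀ i : Fin n, ∫ z, z i ∂P = 1 := fun i => by
      rw [← hm, ← (mp i).map_eq, integral_map (mp i).aemeasurable (by fun_prop)]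
    have hV : ∀ i : Fin n, Var[fun z : Fin n → ℝ => z i; P] = ∫ z, (z-1)^2 ∂ν := fun i => by
      rw [variance_eq_integral (mp i).aemeasurable, hE i]
      conv_rhs => rw [← (mp i).map_eq]
      rw [integral_map (mp i).aemeasurable (by fun_prop)]
    have hind : iIndepFun (fun i (z : Fin n → ℝ) => z i) P :=
      iIndepFun_pi (X := fun _ (x:ℝ) => x) (fun i => aemeasurable_id)
    have hS : Var[∑ i : Fin n, fun z : Fin n → ℝ => z i; P] = n * ∫ z, (z-1)^2 ∂ν := by
      rw [IndepFun.variance_sum (fun i _ => hLi i) (fun i _ j _ hij => hind.indepFun hij)]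
      simp [hV]
    rw [variance_eq_integral (by fun_prop)] at hS
    simp only [Finset.sum_apply] at hS
    rw [integral_finsetSum _ (fun i _ => (hLi i).integrable (by norm_num))] at hS
    simp only [hE, Finset.sum_const, Finset.card_univ, Fintype.card_fin, nsmul_eq_mul,
      mul_one] at hS
    rw [hρ, integral_map hmeas.aemeasurable (by fun_prop)]
    have : (fun z : Fin n → ℝ => ((∑ m, z m) / (n:ℝ) - 1)^2) =
        fun z => ((n:ℝ)^2)⁻¹ * (∑ m, z m - n)^2 := by
      ext z; field_simp
    rw [this, integral_const_mul, hS]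
    field_simp

lemma aux_star (a b : ℝ) (ha1 : a < 1) (hb1 : 1 < b) :
    IsProbabilityMeasure (muStar a b) ∧ muStar a b (Set.Icc a b)ᶜ = 0 ∧
    ∫ z, z ∂(muStar a b) = 1 ∧ ∫ z, (z-1)^2 ∂(muStar a b) = (b-1)*(1-a) := by
  have hba : b - a ≠ 0 := by linarith
  have p1 : 0 ≤ (b-1)/(b-a) := div_nonneg (by linarith) (by linarith)
  have p2 : 0 ≤ (1-a)/(b-a) := div_nonneg (by linarith) (by linarith)
  have int : ∀ f : ℝ → ℝ, ∫ z, f z ∂(muStar a b) =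
      (b-1)/(b-a) * f a + (1-a)/(b-a) * f b := by
    intro f
    have hi : ∀ x : ℝ, Integrable f (Measure.dirac x) := fun x =>
      integrable_dirac (by simp)
    unfold muStar
    rw [integral_add_measure ((hi a).smul_measure_nnreal) ((hi b).smul_measure_nnreal),
      integral_smul_nnreal_measure, integral_smul_nnreal_measure, integral_dirac, integral_dirac]
    simp [NNReal.smul_def, Real.coe_toNNReal, p1, p2]
  refine ⟨⟨?_⟩, ?_, ?_, ?_⟩
  · have := int 1
    simp only [Pi.one_apply, integral_const, smul_eq_mul, mul_one] at this
    have e : (muStar a b).real Set.univ = 1 := by rw [this]; field_simp; ring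
    rw [measureReal_def] at e
    exact (ENNReal.toReal_eq_one_iff _).1 e
  · unfold muStar
    simp [ha1.le.trans hb1.le]
  · rw [int]; field_simp; ring
  · rw [int]; field_simp; ring

/-- **rigidity.** Fix `ε₀ > 0`, `n ≥ 1`, `a := e^{-ε₀}`, `b := e^{ε₀}`,
and let `μ*` be the endpoint two-point law with mean `1`.  Let `μ` be a Borel
probability measure on `[a,b]` with mean `1`, and let `μ̄ₙ`, `μ̄ₙ*` be the laws of the
`n`-fold i.i.d. averages of `μ` and `μ*`.  If both directed hockey-stick transforms of
`μ̄ₙ` and `μ̄ₙ*` agree for every `α ≥ 1`, then `μ = μ*`. -/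
theorem stmt10 (ε₀ : ℝ) (hε : 0 < ε₀) (n : ℕ) (hn : 1 ≤ n)
    (μ : Measure ℝ) [IsProbabilityMeasure μ]
    (hsupp : μ (Set.Icc (Real.exp (-ε₀)) (Real.exp ε₀))ᶜ = 0)
    (hmean : ∫ z, z ∂μ = 1) :
    let a := Real.exp (-ε₀)
    let b := Real.exp ε₀
    let μbar : Measure ℝ :=
      (Measure.pi fun _ : Fin n => μ).map (fun z => (∑ m, z m) / n)
    let μsbar : Measure ℝ :=
      (Measure.pi fun _ : Fin n => muStar a b).map (fun z => (∑ m, z m) / n)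
    (∀ α : ℝ, 1 ≤ α → ∫ t, max (t - α) 0 ∂μbar = ∫ t, max (t - α) 0 ∂μsbar) →
    (∀ α : ℝ, 1 ≤ α → ∫ t, max (1 - α * t) 0 ∂μbar = ∫ t, max (1 - α * t) 0 ∂μsbar) →
    μ = muStar a b := by
  intro a b μbar μsbar h1 h2
  have ha : 0 < a := Real.exp_pos _
  have ha1 : a < 1 := Real.exp_lt_one_iff.2 (by linarith)
  have hb1 : 1 < b := Real.one_lt_exp_iff.2 hε
  obtain ⟨sp, ss, sm, sv⟩ := aux_star a b ha1 hb1
  obtain ⟨p1, q1, v1⟩ := aux_bar a b n hn μ hsupp hmean μbar rfl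
  obtain ⟨p2, q2, v2⟩ := aux_bar a b n hn (muStar a b) ss sm μsbar rfl
  have hn0 : (n:ℝ) ≠ 0 := by positivity
  have e : ∫ t, (t-1)^2 ∂μbar = ∫ t, (t-1)^2 ∂μsbar := by
    rw [aux_second a b ha ha1.le hb1.le μbar q1, aux_second a b ha ha1.le hb1.le μsbar q2]
    congr 2
    · refine intervalIntegral.integral_congr fun s hs => ?_
      rw [Set.uIcc_of_le hb1.le] at hs
      exact h1 s hs.1
    · refine intervalIntegral.integral_congr fun s hs => ?_
      rw [Set.uIcc_of_le ha1.le] at hs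
      beta_reduce
      rw [h2 s⁻¹ ((one_le_inv₀ (lt_of_lt_of_le ha hs.1)).2 hs.2)]
  have hv : ∫ z, (z-1)^2 ∂μ = (b-1)*(1-a) := by
    rw [v1, v2, sv] at e
    exact (div_left_inj' hn0).1 e
  ext s hs
  have := (aux_rigid a b (ha1.trans hb1) μ hsupp hmean hv s hs).trans
    (aux_rigid a b (ha1.trans hb1) (muStar a b) ss sm sv s hs).symm
  rwa [measureReal_def, measureReal_def, ENNReal.toReal_eq_toReal_iff' (measure_ne_top _ _)
    (measure_ne_top _ _)] at this
end

section
/- Let ρ be an anchored law with invertible covariance matrix Σ := ∫ xxᵀ dρ(x), and set B_i := ∫ (1 + γ_iᵀx) xxᵀ dρ(x) for each i. Let θ ∈ Δ_d be a composition with nθ_i an integer for each i, let c : {1,…,n} → {1,…,d} be an assignment with exactly nθ_i indices mapped to i, and let X_1,…,X_n be independent random vectors with X_m distributed according to the measure with density x ↦ 1 + γ_{c(m)}ᵀx with respect to ρ. Define X̄ := (1/n)∑_m X_m and the canonical estimator θ̂ := 𝟙/d + HΣ^{−1}X̄. Then θ̂ is unbiased, E[θ̂] = θ, and its risk is E‖θ̂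 − θ‖₂² = (1/n)∑_{i=1}^d θ_i [tr(Σ^{−1}B_iΣ^{−1}) − (d−1)/d]. -/
open Finset MeasureTheory
open scoped ENNReal

lemma aux_HHt (d : ℕ) (hd : 2 ≤ d)
    (H : Matrix (Fin d) (Fin (d - 1)) ℝ)
    (horth : H.transpose * H = 1)
    (hcolsum : ∀ j, ∑ i, H i j = 0) :
    H * H.transpose = 1 - Matrix.of fun _ _ => (1 / (d : ℝ)) := by
  have hd0 : (d : ℝ) ≠ 0 := by positivity
  set J : Matrix (Fin d) (Fin d) ℝ := Matrix.of fun _ _ => (1 / (d : ℝ)) with hJ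
  have hJH : J * H = 0 := by
    ext i j
    simp [Matrix.mul_apply, hJ, ← Finset.mul_sum, hcolsum]
  have hHJ : H.transpose * J = 0 := by
    ext i j
    simp [Matrix.mul_apply, hJ, ← Finset.sum_mul, hcolsum]
  have hJJ : J * J = J := by
    ext i j
    simp [Matrix.mul_apply, hJ, hd0]
  have hJt : J.transpose = J := by ext i j; simp [hJ]
  have hQt : (1 - J - H * H.transpose).transpose = 1 - J - H * H.transpose := by
    simp [Matrix.transpose_sub, hJt, Matrix.transpose_mul]
  have hPP : H * H.transpose * (H * H.transpose) = H * H.transpose := by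
    rw [Matrix.mul_assoc, ← Matrix.mul_assoc H.transpose, horth, Matrix.one_mul]
  have hJP : J * (H * H.transpose) = 0 := by rw [← Matrix.mul_assoc, hJH, Matrix.zero_mul]
  have hPJ : H * H.transpose * J = 0 := by rw [Matrix.mul_assoc, hHJ, Matrix.mul_zero]
  have hQQ : (1 - J - H * H.transpose) * (1 - J - H * H.transpose) = 1 - J - H * H.transpose := by
    simp only [Matrix.sub_mul, Matrix.mul_sub, hPP, hJP, hPJ, hJJ, Matrix.one_mul, Matrix.mul_one]
    abel
  have htr : (1 - J - H * H.transpose).trace = 0 := by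
    rw [Matrix.trace_sub, Matrix.trace_sub, Matrix.trace_mul_comm, horth]
    simp [Matrix.trace, hJ, hd0]
    rw [Nat.cast_sub (by omega)]; simp
  have h0 : (1 - J - H * H.transpose) = 0 := by
    rw [← Matrix.trace_conjTranspose_mul_self_eq_zero_iff, Matrix.conjTranspose_eq_transpose_of_trivial, hQt, hQQ, htr]
  exact (sub_eq_zero.mp h0).symm

lemma aux_bound (d : ℕ) 
    (H : Matrix (Fin d) (Fin (d - 1)) ℝ)
    (horth : H.transpose * H = 1)
    (hcolsum : ∀ j, ∑ i, H i j = 0) (x : Fin (d-1) → ℝ)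
    (hx : ∀ i, 0 ≤ 1 + ∑ j, H i j * x j) (j : Fin (d-1)) :
    |x j| ≤ ∑ i, |H i j| * d := by
  have hs : ∑ i, (1 + ∑ j, H i j * x j) = d := by
    rw [Finset.sum_add_distrib, Finset.sum_comm]
    simp [← Finset.sum_mul, hcolsum]
  have hle : ∀ i, 1 + ∑ j, H i j * x j ≤ d := fun i => by
    rw [← hs]
    exact Finset.single_le_sum (f := fun i => 1 + ∑ j, H i j * x j) (fun k _ => hx k) (Finset.mem_univ i)
  have hxj : x j = ∑ i, H i j * (1 + ∑ j, H i j * x j) := by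
    have h1 : (H.transpose * H).mulVec x = x := by rw [horth, Matrix.one_mulVec]
    rw [← Matrix.mulVec_mulVec] at h1
    have := congrFun h1 j
    simp only [Matrix.mulVec, dotProduct, Matrix.transpose_apply] at this
    simp only [mul_add, Finset.sum_add_distrib, mul_one, hcolsum, zero_add, this]
  conv_lhs => rw [hxj]
  refine (Finset.abs_sum_le_sum_abs _ _).trans (Finset.sum_le_sum fun i _ => ?_)
  rw [abs_mul, abs_of_nonneg (hx i)]
  exact mul_le_mul_of_nonneg_left (hle i) (abs_nonneg _)

lemma aux_prob_s11 {X : Type*} [MeasurableSpace X] (n : ℕ) (ν : Fin n → Measure X)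
    [∀ m, IsProbabilityMeasure (ν m)] (f : X → ℝ) (hf : ∀ m, MemLp f 2 (ν m)) (a b : ℝ) :
    Integrable (fun ω : Fin n → X => a + b * ∑ m, f (ω m)) (Measure.pi ν) ∧
    (∫ ω : Fin n → X, (a + b * ∑ m, f (ω m)) ∂Measure.pi ν = a + b * ∑ m, ∫ x, f x ∂ν m) ∧
    Integrable (fun ω : Fin n → X => (a + b * ∑ m, f (ω m) - (a + b * ∑ m, ∫ x, f x ∂ν m)) ^ 2)
      (Measure.pi ν) ∧
    (∫ ω : Fin n → X, (a + b * ∑ m, f (ω m) - (a + b * ∑ m, ∫ x, f x ∂ν m)) ^ 2 ∂Measure.pi ν =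
      b ^ 2 * ∑ m, (∫ x, f x ^ 2 ∂ν m - (∫ x, f x ∂ν m) ^ 2)) := by
  have hm : ∀ m, MemLp (fun ω : Fin n → X => f (ω m)) 2 (Measure.pi ν) := fun m =>
    (hf m).comp_measurePreserving (measurePreserving_eval ν m)
  have hS : MemLp (fun ω : Fin n → X => ∑ m, f (ω m)) 2 (Measure.pi ν) :=
    memLp_finsetSum _ fun m _ => hm m
  have hSi : Integrable (fun ω : Fin n → X => ∑ m, f (ω m)) (Measure.pi ν) :=
    hS.integrable one_le_two
  have hI : ∫ ω : Fin n → X, ∑ m, f (ω m) ∂Measure.pi ν = ∑ m, ∫ x, f x ∂ν m := by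
    rw [integral_finsetSum _ fun m _ => (hm m).integrable one_le_two]
    exact Finset.sum_congr rfl fun m _ => integral_comp_eval (hf m).aestronglyMeasurable
  have heq : ∀ ω : Fin n → X, (a + b * ∑ m, f (ω m) - (a + b * ∑ m, ∫ x, f x ∂ν m)) ^ 2 =
      b ^ 2 * (∑ m, f (ω m) - ∑ m, ∫ x, f x ∂ν m) ^ 2 := fun ω => by ring
  refine ⟨(integrable_const a).add (hSi.const_mul b), ?_, ?_, ?_⟩
  · rw [integral_add (integrable_const a) (hSi.const_mul b), integral_const_mul, hI]
    simp
  · simp_rw [heq]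
    exact (hS.sub (memLp_const _)).integrable_sq.const_mul _
  · simp_rw [heq]
    rw [integral_const_mul]
    congr 1
    have hv := ProbabilityTheory.variance_sum_pi (X := fun _ => f) hf
    have he : (∑ m, fun ω : Fin n → X => f (ω m)) = fun ω => ∑ m, f (ω m) := by
      ext ω; simp
    rw [he, ProbabilityTheory.variance_eq_integral hS.aestronglyMeasurable.aemeasurable, hI] at hv
    rw [hv]
    refine Finset.sum_congr rfl fun m _ => ?_
    rw [ProbabilityTheory.variance_eq_sub (hf m)]
    rfl

theorem stmt11 (d : ℕ) (hd : 2 ≤ d)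
    (H : Matrix (Fin d) (Fin (d - 1)) ℝ)
    (horth : H.transpose * H = 1)
    (hcolsum : ∀ j, ∑ i, H i j = 0)
    (ρ : Measure (Fin (d - 1) → ℝ)) [IsProbabilityMeasure ρ]
    (hsupp : ρ {x | ∀ i, 0 ≤ 1 + ∑ j, H i j * x j}ᶜ = 0)
    (hmean : ∫ x, x ∂ρ = 0)
    (n : ℕ) (hn : 1 ≤ n)
    (θ : Fin d → ℝ) (hθ0 : ∀ i, 0 ≤ θ i) (hθ1 : ∑ i, θ i = 1)
    (c : Fin n → Fin d)
    (hc : ∀ i, ((Finset.univ.filter fun m => c m = i).card : ℝ) = n * θ i) :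
    let Sig : Matrix (Fin (d - 1)) (Fin (d - 1)) ℝ :=
      Matrix.of fun j k => ∫ x, x j * x k ∂ρ
    let B : Fin d → Matrix (Fin (d - 1)) (Fin (d - 1)) ℝ :=
      fun i => Matrix.of fun j k => ∫ x, (1 + ∑ l, H i l * x l) * (x j * x k) ∂ρ
    let μ : Measure (Fin n → Fin (d - 1) → ℝ) :=
      Measure.pi fun m => ρ.withDensity fun x => ENNReal.ofReal (1 + ∑ l, H (c m) l * x l)
    let est : (Fin n → Fin (d - 1) → ℝ) → Fin d → ℝ :=
      fun ω => (fun _ => 1 / (d : ℝ)) + H.mulVec (Sig⁻¹.mulVec ((n : ℝ)⁻¹ • ∑ m, ω m))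
    ∀ _ : IsUnit Sig.det,
    (∫ ω, est ω ∂μ = θ) ∧
    (∫ ω, ∑ i, (est ω i - θ i) ^ 2 ∂μ =
      (1 / (n : ℝ)) * ∑ i, θ i * ((Sig⁻¹ * B i * Sig⁻¹).trace - ((d : ℝ) - 1) / d)) := by
  intro Sig B μ est hdet
  have hd0 : (d : ℝ) ≠ 0 := by positivity
  have hn0 : (n : ℝ) ≠ 0 := by positivity
  have hae : ∀ᵐ x ∂ρ, ∀ i, 0 ≤ 1 + ∑ j, H i j * x j := hsupp
  have hbd : ∀ᵐ x ∂ρ, ∀ j, |x j| ≤ ∑ i, |H i j| * d := by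
    filter_upwards [hae] with x hx j using aux_bound d H horth hcolsum x hx j
  have hLp : ∀ (j) (p : ℝ≥0∞), MemLp (fun x : Fin (d-1) → ℝ => x j) p ρ := fun j p =>
    MemLp.of_bound (measurable_pi_apply j).aestronglyMeasurable (∑ i, |H i j| * d) (by
      filter_upwards [hbd] with x hx using hx j)
  have hint1 : ∀ j, Integrable (fun x : Fin (d-1) → ℝ => x j) ρ := fun j =>
    (hLp j 1).integrable le_rfl
  have hint2 : ∀ j k, Integrable (fun x : Fin (d-1) → ℝ => x j * x k) ρ := fun j k =>
    (hLp j 2).integrable_mul (hLp k 2)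
  have hm0 : ∀ j, ∫ x, x j ∂ρ = 0 := fun j => by
    have := eval_integral (μ := ρ) (f := fun x : Fin (d-1) → ℝ => x) hint1 j
    rw [← this, hmean]; rfl
  have hgmeas : ∀ i, Measurable fun x : Fin (d-1) → ℝ => 1 + ∑ l, H i l * x l := fun i => by
    fun_prop
  have hgint : ∀ i, Integrable (fun x : Fin (d-1) → ℝ => 1 + ∑ l, H i l * x l) ρ := fun i =>
    (integrable_const 1).add (integrable_finsetSum _ fun l _ => (hint1 l).const_mul _)
  have hg1 : ∀ i, ∫ x, (1 + ∑ l, H i l * x l) ∂ρ = 1 := fun i => by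
    rw [integral_add (integrable_const 1) (integrable_finsetSum _ fun l _ => (hint1 l).const_mul _),
      integral_finsetSum _ fun l _ => (hint1 l).const_mul _]
    simp [integral_const_mul, hm0]
  let ν : Fin d → Measure (Fin (d-1) → ℝ) := fun i =>
    ρ.withDensity fun x => ENNReal.ofReal (1 + ∑ l, H i l * x l)
  have hνp : ∀ i, IsProbabilityMeasure (ν i) := fun i => ⟨by
    simp only [ν, withDensity_apply _ MeasurableSet.univ, Measure.restrict_univ]
    rw [← ofReal_integral_eq_lintegral_ofReal (hgint i) (by
      filter_upwards [hae] with x hx using hx i), hg1, ENNReal.ofReal_one]⟩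
  have hνI : ∀ i (f : (Fin (d-1) → ℝ) → ℝ),
      ∫ x, f x ∂ν i = ∫ x, (1 + ∑ l, H i l * x l) * f x ∂ρ := fun i f => by
    simp only [ν]
    rw [integral_withDensity_eq_integral_toReal_smul (hgmeas i).ennreal_ofReal (by simp)]
    refine integral_congr_ae ?_
    filter_upwards [hae] with x hx
    rw [ENNReal.toReal_ofReal (hx i), smul_eq_mul]
  have hνac : ∀ i, ν i ≪ ρ := fun i => withDensity_absolutelyContinuous _ _
  have hνLp : ∀ i j (p : ℝ≥0∞), MemLp (fun x : Fin (d-1) → ℝ => x j) p (ν i) := fun i j p =>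
    MemLp.of_bound (measurable_pi_apply j).aestronglyMeasurable (∑ i, |H i j| * d) (by
      filter_upwards [(hνac i).ae_le hbd] with x hx using hx j)
  have hν1 : ∀ i j, ∫ x, x j ∂ν i = ∑ l, H i l * Sig l j := fun i j => by
    rw [hνI]
    simp_rw [add_mul, one_mul, Finset.sum_mul, mul_assoc]
    rw [integral_add (hint1 j) (integrable_finsetSum _ fun l _ => (hint2 l j).const_mul _),
      integral_finsetSum _ fun l _ => (hint2 l j).const_mul _, hm0, zero_add]
    simp_rw [integral_const_mul]
    rfl
  have hν2 : ∀ i j k, ∫ x, x j * x k ∂ν i = B i j k := fun i j k => by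
    rw [hνI]; rfl
  have hSsymm : Sig.transpose = Sig := by
    ext j k
    simp only [Sig, Matrix.transpose_apply, Matrix.of_apply, mul_comm]
  have hHHt := aux_HHt d hd H horth hcolsum
  set S := Sig⁻¹ with hS
  have hSt : S.transpose = S := by rw [hS, Matrix.transpose_nonsing_inv, hSsymm]
  have hSS : Sig * S = 1 := Matrix.mul_nonsing_inv _ hdet
  set A := H * S with hA
  have hAA : A.transpose * A = S * S := by
    rw [hA, Matrix.transpose_mul, hSt, Matrix.mul_assoc, ← Matrix.mul_assoc H.transpose, horth,
      Matrix.one_mul]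
  have hfLp : ∀ i k, MemLp (fun x : Fin (d-1) → ℝ => ∑ j, A i j * x j) 2 (ν k) := fun i k =>
    memLp_finsetSum _ fun j _ => (hνLp k j 2).const_mul _
  -- first moment
  have hf1 : ∀ i k, ∫ x, ∑ j, A i j * x j ∂ν k = (if i = k then 1 else 0) - 1 / d := fun i k => by
    rw [integral_finsetSum _ fun j _ => ((hνLp k j 1).integrable le_rfl).const_mul _]
    simp_rw [integral_const_mul, hν1]
    have h1 : A * (H * Sig).transpose = H * H.transpose := by
      rw [Matrix.transpose_mul, hSsymm, hA, Matrix.mul_assoc, ← Matrix.mul_assoc S,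
        Matrix.nonsing_inv_mul _ hdet, Matrix.one_mul]
    have h2 := congrFun (congrFun (h1.trans hHHt) i) k
    simpa only [Matrix.mul_apply, Matrix.one_apply, Matrix.transpose_apply, Matrix.sub_apply,
      Matrix.of_apply] using h2
  -- second moment
  have hf2 : ∀ k, ∑ i, ∫ x, (∑ j, A i j * x j) ^ 2 ∂ν k = (S * B k * S).trace := fun k => by
    have h1 : ∀ i, ∫ x, (∑ j, A i j * x j) ^ 2 ∂ν k = ∑ j, ∑ l, A i j * A i l * B k j l := by
      intro i
      have h0 : ∀ x : Fin (d-1) → ℝ, (∑ j, A i j * x j) ^ 2 =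
          ∑ j, ∑ l, A i j * A i l * (x j * x l) := fun x => by
        rw [sq, Finset.sum_mul_sum]
        exact Finset.sum_congr rfl fun j _ => Finset.sum_congr rfl fun l _ => by ring
      have hi : ∀ j l, Integrable (fun x : Fin (d-1) → ℝ => A i j * A i l * (x j * x l)) (ν k) :=
        fun j l => ((hνLp k j 2).integrable_mul (hνLp k l 2)).const_mul _
      simp_rw [h0]
      rw [integral_finsetSum _ fun j _ => integrable_finsetSum _ fun l _ => hi j l]
      refine Finset.sum_congr rfl fun j _ => ?_
      rw [integral_finsetSum _ fun l _ => hi j l]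
      simp_rw [integral_const_mul, hν2]
    have hBt : ∀ j l, B k j l = B k l j := fun j l => by
      simp only [B, Matrix.of_apply, mul_comm]
    rw [Matrix.trace_mul_comm, ← Matrix.mul_assoc, ← hAA]
    simp_rw [h1]
    simp only [Matrix.trace, Matrix.diag, Matrix.mul_apply, Matrix.transpose_apply,
      Finset.sum_mul]
    rw [Finset.sum_comm]
    refine Finset.sum_congr rfl fun j _ => ?_
    rw [Finset.sum_comm]
    refine Finset.sum_congr rfl fun l _ => Finset.sum_congr rfl fun i _ => ?_
    rw [hBt j l]
  -- reindexing
  have hre : ∀ g : Fin d → ℝ, ∑ m, g (c m) = n * ∑ i, θ i * g i := fun g => by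
    rw [← Finset.sum_fiberwise' Finset.univ c, Finset.mul_sum]
    refine Finset.sum_congr rfl fun i _ => ?_
    rw [Finset.sum_const, nsmul_eq_mul, hc]; ring
  have hest : ∀ ω i, est ω i = 1 / d + (n : ℝ)⁻¹ * ∑ m, ∑ j, A i j * ω m j := fun ω i => by
    simp only [est]
    rw [Matrix.mulVec_mulVec, ← hA, Matrix.mulVec_smul]
    simp only [Pi.add_apply, Pi.smul_apply, smul_eq_mul, Matrix.mulVec, dotProduct,
      Finset.sum_apply, Finset.mul_sum]
    rw [Finset.sum_comm]
  have hθ : ∀ i, θ i = 1 / d + (n : ℝ)⁻¹ * ∑ m, ∫ x, ∑ j, A i j * x j ∂ν (c m) := fun i => by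
    simp_rw [hf1]
    rw [hre (fun k => (if i = k then 1 else 0) - 1 / d), inv_mul_cancel_left₀ hn0]
    simp [mul_sub, Finset.sum_sub_distrib, ← Finset.sum_mul, hθ1]
  have hP := fun i => aux_prob_s11 n (fun m => ν (c m)) (fun x => ∑ j, A i j * x j)
    (fun m => hfLp i (c m)) (1 / d) (n : ℝ)⁻¹
  have hμ : μ = Measure.pi fun m => ν (c m) := rfl
  constructor
  · ext i
    rw [eval_integral (fun i => by simp_rw [hest]; exact (hP i).1)]
    simp_rw [hest]
    rw [hμ, (hP i).2.1, ← hθ]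
  · simp_rw [hest]
    rw [integral_finsetSum _ fun i _ => by
      have := (hP i).2.2.1
      rw [← hθ] at this
      exact this]
    have h3 : ∀ i, _ := fun i => (hP i).2.2.2
    simp_rw [← hθ] at h3
    rw [hμ]
    simp_rw [h3]
    rw [← Finset.mul_sum, Finset.sum_comm]
    simp_rw [Finset.sum_sub_distrib, hf2, hf1]
    have h4 : ∀ k : Fin d, ∑ i, ((if i = k then 1 else 0) - 1 / (d:ℝ)) ^ 2 = ((d:ℝ) - 1) / d := by
      intro k
      have : ∀ i, ((if i = k then 1 else 0) - 1 / (d:ℝ)) ^ 2 =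
          (if i = k then 1 - 2 / (d:ℝ) else 0) + 1 / (d:ℝ)^2 := fun i => by
        split_ifs <;> ring
      simp_rw [this, Finset.sum_add_distrib]
      simp
      field_simp
      ring
    simp_rw [h4]
    rw [← Finset.sum_sub_distrib, hre (fun k => (S * B k * S).trace - ((d:ℝ) - 1) / d)]
    rw [← mul_assoc]
    congr 1
    field_simp
end

section
/- Let ρ be an anchored law, and define its symmetrization ρ̄ := (1/d!)∑_{π ∈ S_d} (P_π)_# ρ, where P_π := HᵀΠH and Π is the permutation matrix of π. Then: (i) χ_*(ρ̄) ≤ χ_*(ρ), where χ_*(ρ) := max_{i≠j} ∫ ((γ_j − γ_i)ᵀx)²/(1 + γ_iᵀx) dρ(x) ∈ [0,∞] with the convention that the integrand is 0 on {1 + γ_iᵀx = 0, (γ_j − γ_i)ᵀx = 0} and +∞ on {1 + γ_iᵀx = 0, (γ_j − γ_i)ᵀx ≠ 0}; and (ii) the covariance isotropizes: Σ(ρ̄) = (tr Σ(ρ)/(d−1)) I_{d−1}, where Σ(ρ) := ∫ xxᵀ dρ(x). -/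
open Finset MeasureTheory
open scoped ENNReal

theorem aux_proj (d : ℕ) (hd : 2 ≤ d)
    (H : Matrix (Fin d) (Fin (d - 1)) ℝ)
    (horth : H.transpose * H = 1)
    (hcolsum : ∀ j, ∑ i, H i j = 0) :
    ∀ a b, ∑ j, H a j * H b j = (if a = b then 1 else 0) - 1 / (d : ℝ) := by
  have hd0 : (0 : ℝ) < d := by exact_mod_cast (by omega : 0 < d)
  let K : Matrix (Fin d) (Fin (d - 1) ⊕ Unit) ℝ :=
    Matrix.of fun a s => Sum.elim (fun j => H a j) (fun _ => 1 / Real.sqrt d) s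
  have h1 : K.transpose * K = 1 := by
    ext s t
    rcases s with s | s <;> rcases t with t | t
    · have := congrFun (congrFun horth s) t
      simp only [Matrix.mul_apply, Matrix.transpose_apply, Matrix.one_apply] at this
      simp [Matrix.mul_apply, K, this, Matrix.one_apply]
    · simp [Matrix.mul_apply, K, ← Finset.sum_mul, hcolsum]
    · simp [Matrix.mul_apply, K, ← Finset.mul_sum, hcolsum]
    · simp [Matrix.mul_apply, K]
      rw [← mul_inv, Real.mul_self_sqrt hd0.le]
      field_simp
  have h2 : K * K.transpose = 1 := by
    refine (Matrix.mul_eq_one_comm_of_card_eq _ _ _ ?_).mp h1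
    simp
    omega
  intro a b
  have := congrFun (congrFun h2 a) b
  simp [Matrix.mul_apply, K, Matrix.one_apply] at this
  rw [← mul_inv, Real.mul_self_sqrt hd0.le] at this
  rw [← this]; ring

theorem aux_perm {d : ℕ} (hd : 2 ≤ d) (u : Fin d → ℝ) (hu : ∑ i, u i = 0) :
    ∃ c : ℝ, ∀ a b, ∑ π : Equiv.Perm (Fin d), u (π.symm a) * u (π.symm b)
      = (if a = b then (d.factorial : ℝ) * (∑ i, u i ^ 2) / ((d : ℝ) - 1) else 0) + c := by
  have hd1 : (1 : ℝ) < d := by exact_mod_cast hd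
  set M : Fin d → Fin d → ℝ := fun a b =>
    ∑ π : Equiv.Perm (Fin d), u (π.symm a) * u (π.symm b) with hM
  have hinv : ∀ (σ : Equiv.Perm (Fin d)) a b, M (σ a) (σ b) = M a b := by
    intro σ a b
    simp only [hM]
    refine Fintype.sum_equiv (Equiv.mulLeft σ⁻¹) _ _ ?_
    intro π
    rfl
  let o : Fin d := ⟨0, by omega⟩
  let p : Fin d := ⟨1, by omega⟩
  have hop : o ≠ p := by simp [o, p]
  have hdiag : ∀ a, M a a = M o o := by
    intro a
    have := hinv (Equiv.swap o a) o o
    simpa using this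
  have hoff : ∀ a b, a ≠ b → M a b = M o p := by
    intro a b hab
    have h1 := hinv (Equiv.swap a o) a b
    have h2 := hinv (Equiv.swap (Equiv.swap a o b) p) o (Equiv.swap a o b)
    rw [Equiv.swap_apply_left] at h1 h2
    rw [Equiv.swap_apply_of_ne_of_ne] at h2
    · rw [← h1, ← h2]
    · intro h
      apply hab
      have : Equiv.swap a o a = Equiv.swap a o b := by rw [Equiv.swap_apply_left]; exact h
      exact (Equiv.swap a o).injective this
    · exact hop
  have htr : (d : ℝ) * M o o = d.factorial * ∑ i, u i ^ 2 := by
    have h1 : ∑ a, M a a = d * M o o := by simp [hdiag]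
    rw [← h1]
    simp only [hM]
    rw [Finset.sum_comm]
    have : ∀ π : Equiv.Perm (Fin d), ∑ a, u (π.symm a) * u (π.symm a) = ∑ i, u i ^ 2 := by
      intro π
      rw [← Equiv.sum_comp π.symm (fun i => u i ^ 2)]
      exact Finset.sum_congr rfl fun a _ => by ring
    simp [this, Fintype.card_perm]
  have hrow : M o o + ((d : ℝ) - 1) * M o p = 0 := by
    have h1 : ∑ b, M o b = 0 := by
      simp only [hM]
      rw [Finset.sum_comm]
      refine Finset.sum_eq_zero fun π _ => ?_
      rw [← Finset.mul_sum, Equiv.sum_comp π.symm u, hu, mul_zero]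
    have h2 : ∀ b, M o b = (if b = o then M o o - M o p else 0) + M o p := by
      intro b
      by_cases h : b = o
      · simp [h]
      · simp [h, hoff o b (Ne.symm h)]
    rw [Finset.sum_congr rfl (fun b _ => h2 b), Finset.sum_add_distrib] at h1
    simp at h1
    linarith
  refine ⟨M o p, fun a b => ?_⟩
  change M a b = _
  by_cases h : a = b
  · subst h
    rw [hdiag, if_pos rfl, ← htr]
    have : (d : ℝ) - 1 ≠ 0 := by linarith
    field_simp
    linear_combination -hrow
  · simp [h, hoff a b h]

/-- **global symmetrization.** Let `ρ` be an anchored law and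
`ρ̄ := (1/d!) ∑_{π ∈ S_d} (P_π)_# ρ` its symmetrization, where `P_π = HᵀΠH`.  Then:
(i) `χ_*(ρ̄) ≤ χ_*(ρ)`, where
`χ_*(ρ) = max_{i ≠ j} ∫ ((γⱼ-γᵢ)ᵀx)²/(1 + γᵢᵀx) dρ ∈ [0,∞]` with the extended-real
convention on `{1 + γᵢᵀx = 0}`; and (ii) the covariance isotropizes:
`Σ(ρ̄) = (tr Σ(ρ)/(d-1)) I`. -/
theorem stmt14 (d : ℕ) (hd : 2 ≤ d)
    (H : Matrix (Fin d) (Fin (d - 1)) ℝ)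
    (horth : H.transpose * H = 1)
    (hcolsum : ∀ j, ∑ i, H i j = 0)
    (ρ : Measure (Fin (d - 1) → ℝ)) [IsProbabilityMeasure ρ]
    (hsupp : ρ {x | ∀ i, 0 ≤ 1 + ∑ j, H i j * x j}ᶜ = 0)
    (hmean : ∫ x, x ∂ρ = 0) :
    let P : Equiv.Perm (Fin d) → Matrix (Fin (d - 1)) (Fin (d - 1)) ℝ :=
      fun π => H.transpose * (Matrix.of fun i j : Fin d => if i = π j then (1 : ℝ) else 0) * H
    let ρbar : Measure (Fin (d - 1) → ℝ) :=
      ((d.factorial : ℝ≥0∞))⁻¹ • ∑ π : Equiv.Perm (Fin d), ρ.map ((P π).mulVec)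
    let chiInt : Fin d → Fin d → (Fin (d - 1) → ℝ) → ℝ≥0∞ := fun i j x =>
      if 1 + ∑ l, H i l * x l = 0 then
        (if ∑ l, (H j l - H i l) * x l = 0 then 0 else ⊤)
      else ENNReal.ofReal ((∑ l, (H j l - H i l) * x l) ^ 2 / (1 + ∑ l, H i l * x l))
    let chi : Measure (Fin (d - 1) → ℝ) → ℝ≥0∞ := fun μ =>
      ⨆ (i) (j) (_ : i ≠ j), ∫⁻ x, chiInt i j x ∂μ
    let Sig : Measure (Fin (d - 1) → ℝ) → Matrix (Fin (d - 1)) (Fin (d - 1)) ℝ :=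
      fun μ => Matrix.of fun j k => ∫ x, x j * x k ∂μ
    chi ρbar ≤ chi ρ ∧
    Sig ρbar = ((Sig ρ).trace / ((d : ℝ) - 1)) • (1 : Matrix (Fin (d - 1)) (Fin (d - 1)) ℝ) := by
  classical
  intro P ρbar chiInt chi Sig
  have hd0 : (0 : ℝ) < d := by exact_mod_cast (by omega : 0 < d)
  have hproj := aux_proj d hd H horth hcolsum
  have hP : ∀ π (x : Fin (d - 1) → ℝ) j,
      (P π).mulVec x j = ∑ a, H a j * ∑ l, H (π.symm a) l * x l := by
    intro π x j
    have e : P π = H.transpose * ((Matrix.of fun i j : Fin d => if i = π j then (1 : ℝ) else 0) * H) := by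
      simp only [P, Matrix.mul_assoc]
    rw [e, ← Matrix.mulVec_mulVec]
    simp only [Matrix.mulVec, dotProduct, Matrix.transpose_apply]
    refine Finset.sum_congr rfl fun a _ => ?_
    congr 1
    refine Finset.sum_congr rfl fun l _ => ?_
    congr 1
    rw [Matrix.mul_apply]
    rw [Finset.sum_eq_single (π.symm a)]
    · simp
    · intro b _ hb
      have : a ≠ π b := by rintro rfl; simp at hb
      simp [this]
    · simp
  have husum : ∀ x : Fin (d - 1) → ℝ, ∑ a, ∑ l, H a l * x l = 0 := by
    intro x
    rw [Finset.sum_comm]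
    simp [← Finset.sum_mul, hcolsum]
  have hHP : ∀ π (x : Fin (d - 1) → ℝ) k,
      ∑ l, H k l * (P π).mulVec x l = ∑ l, H (π.symm k) l * x l := by
    intro π x k
    have h0 : ∑ a, ∑ l, H (π.symm a) l * x l = 0 := by
      rw [Equiv.sum_comp π.symm (fun a => ∑ l, H a l * x l), husum]
    calc ∑ l, H k l * (P π).mulVec x l
        = ∑ a, (∑ j, H k j * H a j) * ∑ l, H (π.symm a) l * x l := by
          simp only [hP]
          simp only [Finset.mul_sum (s := (Finset.univ : Finset (Fin d)))]
          rw [Finset.sum_comm]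
          refine Finset.sum_congr rfl fun a _ => ?_
          rw [Finset.sum_mul]
          exact Finset.sum_congr rfl fun j _ => by ring
      _ = _ := by
          simp only [hproj, sub_mul, Finset.sum_sub_distrib, ← Finset.mul_sum, h0]
          simp
  have hfac : (d.factorial : ℝ≥0∞) ≠ 0 := by exact_mod_cast d.factorial_ne_zero
  have hmeas : ∀ π, Measurable ((P π).mulVec) := fun π =>
    (Continuous.matrix_mulVec continuous_const continuous_id).measurable
  refine ⟨?_, ?_⟩
  · refine iSup_le fun i => iSup_le fun j => iSup_le fun hij => ?_
    have hb : ∀ π : Equiv.Perm (Fin d),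
        ∫⁻ x, chiInt i j x ∂(ρ.map ((P π).mulVec)) ≤ chi ρ := by
      intro π
      refine (lintegral_map_le _ _).trans ?_
      have : ∀ x, chiInt i j ((P π).mulVec x) = chiInt (π.symm i) (π.symm j) x := by
        intro x
        simp only [chiInt, sub_mul, Finset.sum_sub_distrib, hHP]
      simp only [this]
      exact le_iSup_of_le (π.symm i) (le_iSup_of_le (π.symm j)
        (le_iSup_of_le (fun h => hij (π.symm.injective h)) le_rfl))
    simp only [ρbar, lintegral_smul_measure, lintegral_finsetSum_measure]
    calc _ ≤ (d.factorial : ℝ≥0∞)⁻¹ • ∑ π : Equiv.Perm (Fin d), chi ρ := by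
            simp only [smul_eq_mul]
            gcongr
            exact hb _
      _ = chi ρ := by
            simp only [Finset.sum_const, Finset.card_univ, Fintype.card_perm, Fintype.card_fin,
              nsmul_eq_mul, smul_eq_mul]
            rw [← mul_assoc, ENNReal.inv_mul_cancel hfac (ENNReal.natCast_ne_top _), one_mul]
  · have hnorm : ∀ x : Fin (d - 1) → ℝ, ∀ j, x j = ∑ a, H a j * ∑ l, H a l * x l := by
      intro x j
      have h : (H.transpose * H).mulVec x j = x j := by rw [horth, Matrix.one_mulVec]
      rw [← h, ← Matrix.mulVec_mulVec]
      rfl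
    have hsq : ∀ x : Fin (d - 1) → ℝ, ∑ a, (∑ l, H a l * x l) ^ 2 = ∑ j, x j * x j := by
      intro x
      calc ∑ a, (∑ l, H a l * x l) ^ 2
          = ∑ a, ∑ j, (H a j * x j) * ∑ l, H a l * x l := by
            refine Finset.sum_congr rfl fun a _ => ?_
            rw [← Finset.sum_mul, sq]
        _ = ∑ j, x j * ∑ a, H a j * ∑ l, H a l * x l := by
            rw [Finset.sum_comm]
            refine Finset.sum_congr rfl fun j _ => ?_
            rw [Finset.mul_sum]
            exact Finset.sum_congr rfl fun a _ => by ring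
        _ = _ := Finset.sum_congr rfl fun j _ => by rw [← hnorm]
    have hae : ∀ᵐ x ∂ρ, ∀ i, 0 ≤ 1 + ∑ j, H i j * x j := hsupp
    have hub : ∀ᵐ x ∂ρ, ∀ i, |∑ j, H i j * x j| ≤ d := by
      filter_upwards [hae] with x hx i
      have h1 : 1 + ∑ j, H i j * x j ≤ ∑ i, (1 + ∑ j, H i j * x j) :=
        Finset.single_le_sum (f := fun i => 1 + ∑ j, H i j * x j) (fun i _ => hx i)
          (Finset.mem_univ i)
      rw [Finset.sum_add_distrib, husum] at h1
      simp at h1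
      have hd2 : (2 : ℝ) ≤ d := by exact_mod_cast hd
      rw [abs_le]
      constructor <;> linarith [hx i]
    have hxb : ∀ j, ∀ᵐ x ∂ρ, |x j| ≤ ∑ a, |H a j| * d := by
      intro j
      filter_upwards [hub] with x hx
      rw [hnorm x j]
      refine (Finset.abs_sum_le_sum_abs _ _).trans (Finset.sum_le_sum fun a _ => ?_)
      rw [abs_mul]
      exact mul_le_mul_of_nonneg_left (hx a) (abs_nonneg _)
    have hint : ∀ j k, Integrable (fun x : Fin (d - 1) → ℝ => x j * x k) ρ := by
      intro j k
      refine Integrable.of_bound (by fun_prop) ((∑ a, |H a j| * d) * (∑ a, |H a k| * d)) ?_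
      filter_upwards [hxb j, hxb k] with x h1 h2
      rw [Real.norm_eq_abs, abs_mul]
      exact mul_le_mul h1 h2 (abs_nonneg _) ((abs_nonneg _).trans h1)
    have hintP : ∀ π j k,
        Integrable (fun x : Fin (d - 1) → ℝ => (P π).mulVec x j * (P π).mulVec x k) ρ := by
      intro π j k
      simp only [Matrix.mulVec, dotProduct, Finset.sum_mul_sum]
      refine integrable_finsetSum _ fun a _ => integrable_finsetSum _ fun b _ => ?_
      have := (hint a b).const_mul (P π j a * P π k b)
      refine this.congr (Filter.Eventually.of_forall fun x => ?_)
      simp only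
      ring
    have hpt : ∀ (x : Fin (d - 1) → ℝ) j k,
        ∑ π : Equiv.Perm (Fin d), (P π).mulVec x j * (P π).mulVec x k
          = (if j = k then 1 else 0) * ((d.factorial : ℝ) / ((d : ℝ) - 1)) * ∑ l, x l * x l := by
      intro x j k
      obtain ⟨c, hc⟩ := aux_perm hd (fun a => ∑ l, H a l * x l) (husum x)
      have ho := congrFun (congrFun horth j) k
      simp only [Matrix.mul_apply, Matrix.transpose_apply, Matrix.one_apply] at ho
      calc ∑ π : Equiv.Perm (Fin d), (P π).mulVec x j * (P π).mulVec x k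
          = ∑ a, ∑ b, H a j * H b k * ∑ π : Equiv.Perm (Fin d),
              (∑ l, H (π.symm a) l * x l) * (∑ l, H (π.symm b) l * x l) := by
            simp only [hP]
            simp only [Finset.sum_mul_sum (s := (Finset.univ : Finset (Fin d)))
              (t := (Finset.univ : Finset (Fin d)))]
            rw [Finset.sum_comm]
            refine Finset.sum_congr rfl fun a _ => ?_
            rw [Finset.sum_comm]
            refine Finset.sum_congr rfl fun b _ => ?_
            rw [Finset.mul_sum]
            exact Finset.sum_congr rfl fun π _ => by ring
        _ = ∑ a, (H a j * H a k) * ((d.factorial : ℝ) * (∑ l, x l * x l) / ((d : ℝ) - 1)) := by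
            refine Finset.sum_congr rfl fun a _ => ?_
            have : ∀ b, ∑ π : Equiv.Perm (Fin d),
              (∑ l, H (π.symm a) l * x l) * (∑ l, H (π.symm b) l * x l) = _ := hc a
            simp only [this, mul_add, Finset.sum_add_distrib]
            rw [← Finset.sum_mul, ← Finset.mul_sum, hcolsum]
            simp [hsq]
        _ = _ := by
            rw [← Finset.sum_mul, ho]
            ring
    ext j k
    have hmap : ∀ π, ∫ x, x j * x k ∂(ρ.map ((P π).mulVec))
        = ∫ x, (P π).mulVec x j * (P π).mulVec x k ∂ρ := by
      intro π
      rw [integral_map (hmeas π).aemeasurable]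
      exact Continuous.aestronglyMeasurable (by fun_prop)
    have hL : Sig ρbar j k = (d.factorial : ℝ)⁻¹ *
        ∑ π : Equiv.Perm (Fin d), ∫ x, (P π).mulVec x j * (P π).mulVec x k ∂ρ := by
      simp only [Sig, ρbar, Matrix.of_apply]
      rw [integral_smul_measure, integral_finsetSum_measure]
      · simp [hmap]
      · intro π _
        rw [integrable_map_measure (Continuous.aestronglyMeasurable (by fun_prop))
          (hmeas π).aemeasurable]
        exact hintP π j k
    rw [hL, ← integral_finsetSum _ (fun π _ => hintP π j k)]
    simp only [hpt]
    rw [integral_const_mul, integral_finsetSum _ (fun l _ => hint l l)]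
    simp only [Matrix.smul_apply, Matrix.one_apply, Matrix.trace, Matrix.diag, Sig,
      Matrix.of_apply, smul_eq_mul]
    have hf : (d.factorial : ℝ) ≠ 0 := by exact_mod_cast d.factorial_ne_zero
    field_simp
end

section
/- Let d ≥ 3 and let a ∈ ℝ^d satisfy a_i > 0 for all i and ∑_{i=1}^d a_i = d. Set A := ∑_i a_i^{−1} and B := ∑_i a_i². Then (B − d)(d + 2√(d−1)) ≤ AB − d². Equality holds if and only if a = 𝟙 or a is a coordinate permutation of the singleton template a_⋆ whose one high coordinate equals d√(d−1)/(√(d−1) + d − 1) and whose remaining d−1 coordinates each equal d/(√(d−1) + d − 1). -/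
open Finset

/-- Splitting off one coordinate when the others share a common value. -/
lemma sum_split_aux {d : ℕ} (f : Fin d → ℝ) (k : Fin d) (l : ℝ) (h : ∀ i, i ≠ k → f i = l) :
    ∑ i, f i = f k + ((d : ℝ) - 1) * l := by
  have hd1 : 1 ≤ d := by have := k.isLt; omega
  rw [← Finset.add_sum_erase univ f (mem_univ k)]
  rw [Finset.sum_congr rfl (fun i hi => h i (Finset.ne_of_mem_erase hi))]
  rw [Finset.sum_const, Finset.card_erase_of_mem (mem_univ k), Finset.card_univ, Fintype.card_fin,
    nsmul_eq_mul, Nat.cast_sub hd1, Nat.cast_one]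

/-- Samuelson-type bound for one coordinate. -/
lemma coord_bound {d : ℕ} (b : Fin d → ℝ) (hb : ∑ i, b i = 0) (k : Fin d) :
    (d : ℝ) * b k ^ 2 ≤ ((d : ℝ) - 1) * ∑ i, b i ^ 2 := by
  have hd1 : 1 ≤ d := by have := k.isLt; omega
  have h1 := Finset.add_sum_erase univ b (mem_univ k)
  have h2 := Finset.add_sum_erase univ (fun i => b i ^ 2) (mem_univ k)
  have h3 := sq_sum_le_card_mul_sum_sq (s := univ.erase k) (f := b)
  rw [Finset.card_erase_of_mem (mem_univ k), Finset.card_univ, Fintype.card_fin,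
    Nat.cast_sub hd1, Nat.cast_one] at h3
  have h4 : ∑ i ∈ univ.erase k, b i = - b k := by linarith
  rw [h4] at h3
  rw [← h2]
  nlinarith

set_option maxHeartbeats 2000000 in
/-- **pointwise slope inequality.** Let `d ≥ 3` and let `a ∈ ℝ^d` have
positive coordinates summing to `d`.  With `A = ∑ᵢ aᵢ⁻¹` and `B = ∑ᵢ aᵢ²`, one has
`(B - d)(d + 2√(d-1)) ≤ AB - d²`, with equality iff `a = 𝟙` or `a` is a coordinate
permutation of the singleton GRR template `a⋆` with one high coordinate
`d√(d-1)/(√(d-1) + d - 1)` and `d-1` low coordinates `d/(√(d-1) + d - 1)`. -/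
theorem stmt16 (d : ℕ) (hd : 3 ≤ d)
    (a : Fin d → ℝ) (hpos : ∀ i, 0 < a i) (hsum : ∑ i, a i = (d : ℝ)) :
    let A : ℝ := ∑ i, (a i)⁻¹
    let B : ℝ := ∑ i, (a i) ^ 2
    (B - d) * ((d : ℝ) + 2 * Real.sqrt ((d : ℝ) - 1)) ≤ A * B - (d : ℝ) ^ 2 ∧
    ((B - d) * ((d : ℝ) + 2 * Real.sqrt ((d : ℝ) - 1)) = A * B - (d : ℝ) ^ 2 ↔
      (∀ i, a i = 1) ∨
        ∃ k, a k = (d : ℝ) * Real.sqrt ((d : ℝ) - 1) / (Real.sqrt ((d : ℝ) - 1) + d - 1) ∧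
          ∀ i, i ≠ k → a i = (d : ℝ) / (Real.sqrt ((d : ℝ) - 1) + d - 1)) := by
  intro A B
  have hdR : (3 : ℝ) ≤ d := by exact_mod_cast hd
  obtain ⟨s, hs⟩ : ∃ s, s = Real.sqrt ((d : ℝ) - 1) := ⟨_, rfl⟩
  have hs2 : s ^ 2 = (d : ℝ) - 1 := by rw [hs]; exact Real.sq_sqrt (by linarith)
  have hs0 : 0 ≤ s := by rw [hs]; exact Real.sqrt_nonneg _
  have hs1 : 1 < s := by nlinarith
  have hds : (d : ℝ) = s ^ 2 + 1 := by linarith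
  rw [← hs]
  have hBdef : B = ∑ i, (a i) ^ 2 := rfl
  have hAdef : A = ∑ i, (a i)⁻¹ := rfl
  have hvar : ∑ i, (a i - 1) ^ 2 = B - d := by
    have : ∀ i, (a i - 1) ^ 2 = a i ^ 2 - 2 * a i + 1 := fun i => by ring
    simp only [this, Finset.sum_add_distrib, Finset.sum_sub_distrib, ← Finset.mul_sum, hsum]
    simp [hBdef]; ring
  have hBd : 0 ≤ B - d := by rw [← hvar]; exact Finset.sum_nonneg fun i _ => sq_nonneg _
  have hzero : ∑ i, (a i - 1) = 0 := by simp [Finset.sum_sub_distrib, hsum]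
  have hdpos : (0 : ℝ) < d := by linarith
  obtain ⟨u, hu⟩ : ∃ u, u = Real.sqrt ((B - d) / (d * s ^ 2)) := ⟨_, rfl⟩
  have hu0 : 0 ≤ u := by rw [hu]; exact Real.sqrt_nonneg _
  have hu2 : u ^ 2 = (B - d) / (d * s ^ 2) := by
    rw [hu]; exact Real.sq_sqrt (by positivity)
  have hBu : B = d + d * s ^ 2 * u ^ 2 := by
    rw [hu2]; field_simp; ring
  have halt : ∀ i, a i < d := by
    intro i
    have h1 := Finset.add_sum_erase univ a (mem_univ i)
    have h2 : 0 < ∑ j ∈ univ.erase i, a j := by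
      apply Finset.sum_pos (fun j _ => hpos j)
      rw [← Finset.card_pos, Finset.card_erase_of_mem (mem_univ i), Finset.card_univ,
        Fintype.card_fin]
      omega
    linarith
  have hBlt : B < d ^ 2 := by
    have h1 : ∑ i, a i ^ 2 < ∑ i, (d : ℝ) * a i := by
      apply Finset.sum_lt_sum_of_nonempty
      · exact ⟨⟨0, by omega⟩, mem_univ _⟩
      · intro i _
        nlinarith [hpos i, halt i]
    rw [← Finset.mul_sum, hsum] at h1
    rw [hBdef]; nlinarith
  have hu1 : u < 1 := by
    by_contra h
    have h1 : 1 ≤ u ^ 2 := by nlinarith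
    have h2 : (d : ℝ) * s ^ 2 ≤ d * s ^ 2 * u ^ 2 := by
      have : 0 ≤ (d : ℝ) * s ^ 2 := by positivity
      nlinarith
    rw [hs2] at *
    nlinarith
  have hax : ∀ i, a i ≤ 1 + s ^ 2 * u := by
    intro i
    have h1 := coord_bound (fun i => a i - 1) hzero i
    rw [hvar, ← hs2] at h1
    have h2 : (d : ℝ) * (a i - 1) ^ 2 ≤ d * (s ^ 2 * u) ^ 2 := by
      refine h1.trans (le_of_eq ?_)
      rw [hBu]; ring
    have h3 := le_of_mul_le_mul_left h2 hdpos
    have h4 := abs_le_of_sq_le_sq h3 (by positivity)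
    linarith [(abs_le.1 h4).2]
  have hy : 0 < 1 - u := by linarith
  have hx : 0 < 1 + s ^ 2 * u := by positivity
  have hBpos : 0 < B := by linarith
  have hterm : ∀ i, 0 ≤ (a i - (1 - u)) ^ 2 * (1 + s ^ 2 * u - a i) * (a i)⁻¹ := fun i =>
    mul_nonneg (mul_nonneg (sq_nonneg _) (by linarith [hax i])) (inv_nonneg.2 (hpos i).le)
  obtain ⟨S, hS⟩ : ∃ S, S = ∑ i, (a i - (1 - u)) ^ 2 * (1 + s ^ 2 * u - a i) * (a i)⁻¹ := ⟨_, rfl⟩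
  have hS0 : 0 ≤ S := by rw [hS]; exact Finset.sum_nonneg fun i _ => hterm i
  have hSe : S = -B + (2 * (1 - u) + (1 + s ^ 2 * u)) * d
      - d * ((1 - u) ^ 2 + 2 * (1 + s ^ 2 * u) * (1 - u))
      + (1 + s ^ 2 * u) * (1 - u) ^ 2 * A := by
    have : ∀ i, (a i - (1 - u)) ^ 2 * (1 + s ^ 2 * u - a i) * (a i)⁻¹ =
        -(a i ^ 2) + (2 * (1 - u) + (1 + s ^ 2 * u)) * a i
        - ((1 - u) ^ 2 + 2 * (1 + s ^ 2 * u) * (1 - u))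
        + (1 + s ^ 2 * u) * (1 - u) ^ 2 * (a i)⁻¹ := by
      intro i
      have := (hpos i).ne'
      field_simp
      ring
    rw [hS]
    simp only [this, Finset.sum_add_distrib, Finset.sum_sub_distrib, ← Finset.mul_sum, hsum,
      Finset.sum_neg_distrib, ← hBdef, ← hAdef]
    simp
    ring
  have key : (1 + s ^ 2 * u) * (1 - u) ^ 2 *
      (A * B - (d : ℝ) ^ 2 - (B - d) * ((d : ℝ) + 2 * s)) =
      B * S + d * (1 - u) * (s * u) ^ 2 * ((1 + s) * (s * u) - (s - 1)) ^ 2 := by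
    rw [hSe, hBu, hds]
    ring
  have hc : 0 < (1 + s ^ 2 * u) * (1 - u) ^ 2 := by positivity
  have hT : 0 ≤ d * (1 - u) * (s * u) ^ 2 * ((1 + s) * (s * u) - (s - 1)) ^ 2 := by positivity
  have hBS : 0 ≤ B * S := by positivity
  refine ⟨?_, ?_, ?_⟩
  · have : 0 ≤ A * B - (d : ℝ) ^ 2 - (B - d) * ((d : ℝ) + 2 * s) := by
      refine nonneg_of_mul_nonneg_right ?_ hc
      rw [key]; positivity
    linarith
  · intro h
    have h0 : A * B - (d : ℝ) ^ 2 - (B - d) * ((d : ℝ) + 2 * s) = 0 := by linarith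
    rw [h0, mul_zero] at key
    have hBS0 : B * S = 0 := by linarith
    have hT0 : d * (1 - u) * (s * u) ^ 2 * ((1 + s) * (s * u) - (s - 1)) ^ 2 = 0 := by linarith
    have hS00 : S = 0 := (mul_eq_zero.1 hBS0).resolve_left hBpos.ne'
    have hall : ∀ i, a i = 1 - u ∨ a i = 1 + s ^ 2 * u := by
      intro i
      rw [hS] at hS00
      have h1 := (Finset.sum_eq_zero_iff_of_nonneg (fun i _ => hterm i)).1 hS00 i (mem_univ i)
      rcases mul_eq_zero.1 h1 with h2 | h2
      · rcases mul_eq_zero.1 h2 with h3 | h3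
        · left; have := pow_eq_zero_iff (two_ne_zero) |>.1 h3; linarith
        · right; linarith
      · exact absurd h2 (inv_ne_zero (hpos i).ne')
    rcases hu0.eq_or_lt with hu00 | hupos
    · left
      intro i
      rcases hall i with h1 | h1 <;> rw [h1, ← hu00] <;> ring
    · right
      have hsig : (1 + s) * (s * u) - (s - 1) = 0 := by
        have hne : d * (1 - u) * (s * u) ^ 2 ≠ 0 := by positivity
        exact pow_eq_zero_iff (two_ne_zero) |>.1 ((mul_eq_zero.1 hT0).resolve_left hne)
      have hex : ∃ k, a k = 1 + s ^ 2 * u := by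
        by_contra hno
        push Not at hno
        have h1 : ∀ i, a i = 1 - u := fun i => (hall i).resolve_right (hno i)
        have h2 : ∑ i, (a i - 1) = (d : ℝ) * (-u) := by
          rw [Finset.sum_congr rfl (fun i _ => show a i - 1 = -u by rw [h1 i]; ring)]
          rw [Finset.sum_const, Finset.card_univ, Fintype.card_fin, nsmul_eq_mul]
        rw [hzero] at h2
        have h3 : 0 < (d : ℝ) * u := by positivity
        linarith
      obtain ⟨k, hk⟩ := hex
      have hlow : ∀ i, i ≠ k → a i = 1 - u := by
        intro i hik
        rcases hall i with h1 | h1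
        · exact h1
        · exfalso
          have h2 : ∑ j ∈ {i, k}, (a j - 1) ^ 2 ≤ ∑ j, (a j - 1) ^ 2 :=
            Finset.sum_le_sum_of_subset_of_nonneg (subset_univ _) (fun _ _ _ => sq_nonneg _)
          rw [Finset.sum_pair hik, hvar, h1, hk, hBu, hds] at h2
          have h3 : 0 < s ^ 2 * u ^ 2 := by positivity
          have h4 : 0 < s ^ 2 - 1 := by nlinarith
          nlinarith [mul_pos h3 h4]
      have hden : s + (s ^ 2 + 1) - 1 ≠ 0 := by
        have : 0 < s + (s ^ 2 + 1) - 1 := by nlinarith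
        exact this.ne'
      refine ⟨k, ?_, ?_⟩
      · rw [hk, hds, eq_div_iff hden]
        linear_combination s ^ 2 * hsig
      · intro i hik
        rw [hlow i hik, hds, eq_div_iff hden]
        linear_combination -hsig
  · have hspos : 0 < s := by linarith
    rintro (h1 | ⟨k, hk, hl⟩)
    · have hB1 : B = d := by simp [hBdef, h1]
      have hA1 : A = d := by simp [hAdef, h1]
      rw [hB1, hA1]; ring
    · have hden : s + d - 1 = s * (s + 1) := by rw [hds]; ring
      rw [hden] at hk hl
      have hB1 := sum_split_aux (fun i => a i ^ 2) k _ (fun i hi => by simp only [hl i hi]; rfl)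
      have hA1 := sum_split_aux (fun i => (a i)⁻¹) k _ (fun i hi => by simp only [hl i hi]; rfl)
      simp only [hk] at hB1 hA1
      rw [hBdef, hAdef, hB1, hA1, hds]
      field_simp
      ring
end

section
/- Let d ≥ 2 and λ > 1, and define the ratio-capped polytope 𝒦_{d,λ} := {a ∈ ℝ^d : a_i ≥ 0 for all i, ∑_i a_i = d, and a_i ≤ λ a_j for all i,j}. Then a ∈ 𝒦_{d,λ} is an extreme point of 𝒦_{d,λ} if and only if there exist s ∈ {1,…,d−1} and a subset S ⊆ {1,…,d} with |S| = s such that a_i = λd/(d + s(λ−1)) for all i ∈ S and a_i = d/(d + s(λ−1)) for all i ∉ S; that is, the extreme points are exactly the coordinate permutations of the two-level templates a^{(s)}_λ for s = 1,…,d−1. -/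
open Finset

/-- In an extreme point, every coordinate is tight against some other coordinate. -/
lemma extreme_tight (d : ℕ) (lam : ℝ) (hlam : 1 < lam) (a : Fin d → ℝ)
    (K : Set (Fin d → ℝ))
    (hK : K = {a | (∀ i, 0 ≤ a i) ∧ (∑ i, a i = (d : ℝ)) ∧ ∀ i j, a i ≤ lam * a j})
    (ha : a ∈ K.extremePoints ℝ) (hpos : ∀ i, 0 < a i) (k : Fin d) (hk : a k < d) :
    ∃ i, lam * a i ≤ a k ∨ lam * a k ≤ a i := by
  by_contra! hcon
  have haK : a ∈ K := ha.1
  have haK' := haK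
  rw [hK] at haK'
  obtain ⟨h0, hsum, hrat⟩ := haK'
  let x : ℝ → Fin d → ℝ := fun e i => (1 - e) * a i + if i = k then e * d else 0
  have hev : ∀ᶠ e : ℝ in nhds 0, x e ∈ K := by
    have e1 : ∀ᶠ e : ℝ in nhds 0, 0 < 1 - e :=
      (by fun_prop : Continuous fun e : ℝ => 1 - e).continuousAt.eventually_const_lt (by simp)
    have e2 : ∀ᶠ e : ℝ in nhds 0, 0 < (1 - e) * a k + e * d :=
      (by fun_prop : Continuous fun e : ℝ => (1 - e) * a k + e * d).continuousAt.eventually_const_lt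
        (by simpa using hpos k)
    have e3 : ∀ᶠ e : ℝ in nhds 0, ∀ i, 0 < lam * ((1 - e) * a i) - ((1 - e) * a k + e * d) := by
      rw [Filter.eventually_all]
      intro i
      refine (by fun_prop : Continuous fun e : ℝ =>
        lam * ((1 - e) * a i) - ((1 - e) * a k + e * d)).continuousAt.eventually_const_lt ?_
      have := (hcon i).1
      simp; linarith
    have e4 : ∀ᶠ e : ℝ in nhds 0, ∀ i, 0 < lam * ((1 - e) * a k + e * d) - (1 - e) * a i := by
      rw [Filter.eventually_all]
      intro i
      refine (by fun_prop : Continuous fun e : ℝ =>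
        lam * ((1 - e) * a k + e * d) - (1 - e) * a i).continuousAt.eventually_const_lt ?_
      have := (hcon i).2
      simp; linarith
    filter_upwards [e1, e2, e3, e4] with e h1 h2 h3 h4
    rw [hK]
    refine ⟨fun i => ?_, ?_, fun i j => ?_⟩
    · by_cases hi : i = k
      · subst hi; simpa [x] using h2.le
      · simpa [x, hi] using mul_nonneg h1.le (h0 i)
    · simp only [x, Finset.sum_add_distrib, ← Finset.mul_sum, hsum]
      simp; ring
    · by_cases hi : i = k
      · by_cases hj : j = k
        · subst hi; subst hj
          simp only [x, if_true]
          nlinarith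
        · subst hi
          have := h3 j
          simp only [x, if_true, hj, if_false]
          linarith
      · by_cases hj : j = k
        · subst hj
          have := h4 i
          simp only [x, if_true, hi, if_false]
          linarith
        · simp only [x, hi, hj, if_false]
          have := mul_le_mul_of_nonneg_left (hrat i j) h1.le
          linarith
  obtain ⟨δ, hδ, hball⟩ := Metric.eventually_nhds_iff.1 hev
  have hp : x (δ / 2) ∈ K := hball (by rw [Real.dist_eq, sub_zero, abs_of_pos] <;> linarith)
  have hm : x (-(δ / 2)) ∈ K := hball (by
    rw [Real.dist_eq, sub_zero, abs_neg, abs_of_pos] <;> linarith)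
  have hseg : a ∈ openSegment ℝ (x (δ / 2)) (x (-(δ / 2))) := by
    refine ⟨1 / 2, 1 / 2, by norm_num, by norm_num, by norm_num, ?_⟩
    ext i
    simp only [x, Pi.add_apply, Pi.smul_apply, smul_eq_mul]
    split_ifs <;> ring
  have h := congrFun (ha.2 hp hm hseg) k
  simp only [x, if_true] at h
  nlinarith

/-- If all coordinates take two levels, the lower one is determined by the sum. -/
lemma two_level_sum (d : ℕ) (lam c : ℝ) (hd : 0 < d) (hlam : 1 < lam) (x : Fin d → ℝ)
    (S : Finset (Fin d)) (hsum : ∑ i, x i = (d : ℝ))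
    (h1 : ∀ i ∈ S, x i = lam * c) (h2 : ∀ i ∉ S, x i = c) :
    c = (d : ℝ) / ((d : ℝ) + (S.card : ℝ) * (lam - 1)) := by
  have hx : ∀ i, x i = c + if i ∈ S then (lam - 1) * c else 0 := by
    intro i
    split_ifs with h
    · rw [h1 i h]; ring
    · rw [h2 i h]; ring
  have hd' : (0 : ℝ) < d := by exact_mod_cast hd
  have : (0 : ℝ) ≤ (S.card : ℝ) * (lam - 1) := mul_nonneg (by positivity) (by linarith)
  rw [eq_div_iff (by linarith)]
  simp only [hx, Finset.sum_add_distrib, Finset.sum_ite_mem] at hsum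
  simp at hsum
  linarith

/-- **extreme points of the ratio-capped polytope.** Let `d ≥ 2` and
`λ > 1`, and let `𝒦_{d,λ} = {a : aᵢ ≥ 0, ∑ aᵢ = d, aᵢ ≤ λaⱼ ∀ i,j}`.  A point
`a ∈ 𝒦_{d,λ}` is extreme iff there are `s ∈ {1,…,d-1}` and a subset `S` of size `s`
with `aᵢ = λd/(d + s(λ-1))` on `S` and `aᵢ = d/(d + s(λ-1))` off `S`; i.e. the extreme
points are exactly the coordinate permutations of the two-level templates
`a^{(s)}_λ`, `s = 1,…,d-1`. -/
theorem stmt18 (d : ℕ) (hd : 2 ≤ d) (lam : ℝ) (hlam : 1 < lam) :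
    let K : Set (Fin d → ℝ) :=
      {a | (∀ i, 0 ≤ a i) ∧ (∑ i, a i = (d : ℝ)) ∧ ∀ i j, a i ≤ lam * a j}
    ∀ a ∈ K,
      (a ∈ K.extremePoints ℝ ↔
        ∃ s : ℕ, 1 ≤ s ∧ s ≤ d - 1 ∧
          ∃ S : Finset (Fin d), S.card = s ∧
            (∀ i ∈ S, a i = lam * (d : ℝ) / ((d : ℝ) + (s : ℝ) * (lam - 1))) ∧
            (∀ i ∉ S, a i = (d : ℝ) / ((d : ℝ) + (s : ℝ) * (lam - 1)))) := by
  intro K a haK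
  have hd0 : 0 < d := by omega
  have hdR : (0 : ℝ) < d := by exact_mod_cast hd0
  constructor
  · intro ha
    obtain ⟨h0, hsum, hrat⟩ := haK
    haveI : Nonempty (Fin d) := ⟨⟨0, hd0⟩⟩
    have hpos : ∀ i, 0 < a i := by
      intro i
      refine lt_of_le_of_ne (h0 i) fun hi => ?_
      have : ∑ j, a j = 0 := Finset.sum_eq_zero fun j _ => by
        have h1 := hrat j i
        rw [← hi, mul_zero] at h1
        exact le_antisymm h1 (h0 j)
      linarith
    have hlt : ∀ k, a k < d := by
      intro k
      haveI : Nontrivial (Fin d) := Fin.nontrivial_iff_two_le.2 hd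
      obtain ⟨j, hj⟩ := exists_ne k
      rw [← hsum]
      exact Finset.single_lt_sum hj (Finset.mem_univ _) (Finset.mem_univ _) (hpos j)
        fun i _ _ => h0 i
    have htight := fun k => extreme_tight d lam hlam a K rfl ha hpos k (hlt k)
    obtain ⟨j0, hj0⟩ := Finite.exists_min a
    have hm := hpos j0
    let S : Finset (Fin d) := Finset.univ.filter fun i => a i = lam * a j0
    have hS : ∀ i ∈ S, a i = lam * a j0 := fun i hi => (Finset.mem_filter.1 hi).2
    have hS' : ∀ i ∉ S, a i = a j0 := by
      intro i hi
      have hne : a i ≠ lam * a j0 := fun h => hi (Finset.mem_filter.2 ⟨Finset.mem_univ _, h⟩)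
      obtain ⟨j, h | h⟩ := htight i
      · exfalso
        apply hne
        have := hrat i j0
        have := hj0 j
        nlinarith
      · have h1 := hrat j j0
        have h2 := hj0 i
        nlinarith
    have hj0S : j0 ∉ S := fun h => by
      have := hS j0 h
      nlinarith
    have hSne : S.Nonempty := by
      obtain ⟨j, h | h⟩ := htight j0
      · exfalso
        have := hj0 j
        nlinarith
      · exact ⟨j, Finset.mem_filter.2 ⟨Finset.mem_univ _, le_antisymm (hrat j j0) h⟩⟩
    have hc := two_level_sum d lam (a j0) hd0 hlam a S hsum hS hS'
    have hcard : S.card < d := by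
      have := Finset.card_lt_univ_of_notMem hj0S
      simpa using this
    refine ⟨S.card, hSne.card_pos, by omega, S, rfl, fun i hi => ?_, fun i hi => ?_⟩
    · rw [hS i hi, mul_div_assoc, ← hc]
    · rw [hS' i hi, ← hc]
  · rintro ⟨s, hs1, hs2, S, hSc, hS, hS'⟩
    refine ⟨haK, ?_⟩
    rintro x ⟨hx0, hxs, hxr⟩ y ⟨hy0, hys, hyr⟩ ⟨p, q, hp, hq, hpq, hxy⟩
    obtain ⟨i0, hi0⟩ : S.Nonempty := Finset.card_pos.1 (by omega)
    obtain ⟨j0, hj0⟩ : ∃ j, j ∉ S := by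
      by_contra! h
      have : S = Finset.univ := Finset.eq_univ_iff_forall.2 h
      rw [this, Finset.card_univ, Fintype.card_fin] at hSc
      omega
    have key : ∀ i ∈ S, ∀ j ∉ S, x i = lam * x j := by
      intro i hi j hj
      have h1 : a i = lam * a j := by rw [hS i hi, hS' j hj, mul_div_assoc]
      rw [← hxy] at h1
      simp only [Pi.add_apply, Pi.smul_apply, smul_eq_mul] at h1
      have h2 := hxr i j
      have h3 := mul_le_mul_of_nonneg_left (hyr i j) hq.le
      refine le_antisymm h2 ?_
      by_contra! h4
      have := mul_lt_mul_of_pos_left h4 hp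
      linarith
    have hlow : ∀ j ∉ S, x j = x j0 := by
      intro j hj
      have h1 := key i0 hi0 j hj
      have h2 := key i0 hi0 j0 hj0
      exact mul_left_cancel₀ (by linarith : lam ≠ 0) (h1.symm.trans h2)
    have hc := two_level_sum d lam (x j0) hd0 hlam x S hxs (fun i hi => key i hi j0 hj0) hlow
    rw [hSc] at hc
    ext i
    by_cases hi : i ∈ S
    · rw [hS i hi, key i hi j0 hj0, hc, mul_div_assoc]
    · rw [hS' i hi, hlow i hi, hc]
end

section
/- Let d ≥ 2 and λ > 1, and for 1 ≤ s ≤ d−1 set T_{d,λ}(s) := d·s(d−s)(λ−1)²/(d + s(λ−1))² and T_d^*(λ) := max_{1 ≤ s ≤ d−1} T_{d,λ}(s). Then: (i) max over a in the ratio-capped polytope 𝒦_{d,λ} := {a ∈ ℝ^d : a_i ≥ 0, ∑_i a_i = d, a_i ≤ λ a_j for all i,j} of ∑_i a_i² − d equals T_d^*(λ); (ii) every anchored law ρ such that ρ-almost every x satisfies 1 + γ_iᵀx ≤ λ(1 + γ_jᵀx) for all i,j obeys tr Σ(ρ) ≤ T_d^*(λ), where Σ(ρ) := ∫ xxᵀ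 dρ(x); and (iii) every integer maximizer s of T_{d,λ} lies in {⌊d/(λ+1)⌋, ⌈d/(λ+1)⌉} ∩ {1,…,d−1}. -/
open Finset MeasureTheory
open scoped ENNReal

lemma quad_box (A R k p q t : ℝ) (hk : k ≤ 1) (hp : p ≤ t) (hq : t ≤ q)
    (h1 : (p ^ 2 + A) - k * (p + R) ^ 2 ≤ 0) (h2 : (q ^ 2 + A) - k * (q + R) ^ 2 ≤ 0) :
    (t ^ 2 + A) - k * (t + R) ^ 2 ≤ 0 := by
  rcases eq_or_lt_of_le (hp.trans hq) with h | h
  · have : t = p := le_antisymm (h ▸ hq) hp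
    rw [this]; exact h1
  · by_contra hc
    push Not at hc
    have e : (q - p) * ((t ^ 2 + A) - k * (t + R) ^ 2) =
      (q - t) * ((p ^ 2 + A) - k * (p + R) ^ 2) + (t - p) * ((q ^ 2 + A) - k * (q + R) ^ 2)
      - (1 - k) * ((t - p) * (q - t) * (q - p)) := by ring
    have e1 := mul_nonneg (sub_nonneg.2 hq) (neg_nonneg.2 h1)
    have e2 := mul_nonneg (sub_nonneg.2 hp) (neg_nonneg.2 h2)
    have e3 := mul_nonneg (sub_nonneg.2 hk)
      (mul_nonneg (mul_nonneg (sub_nonneg.2 hp) (sub_nonneg.2 hq)) (sub_nonneg.2 h.le))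
    have e4 := mul_pos (sub_pos.2 h) hc
    linarith

lemma box_max {d : ℕ} (k p q : ℝ) (hk : k ≤ 1) (hpq : p ≤ q)
    (hv : ∀ b : Fin d → ℝ, (∀ i, b i = p ∨ b i = q) → (∑ i, b i ^ 2) - k * (∑ i, b i) ^ 2 ≤ 0)
    (S : Finset (Fin d)) :
    ∀ b : Fin d → ℝ, (∀ i, p ≤ b i ∧ b i ≤ q) → (∀ i, i ∉ S → b i = p ∨ b i = q) →
      (∑ i, b i ^ 2) - k * (∑ i, b i) ^ 2 ≤ 0 := by
  classical
  induction S using Finset.induction_on with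
  | empty => intro b _ h; exact hv b (fun i => h i (by simp))
  | insert i S hi ih =>
    intro b hb h
    have key : ∀ t, (t = p ∨ t = q) →
        (t ^ 2 + ∑ j ∈ univ.erase i, b j ^ 2) - k * (t + ∑ j ∈ univ.erase i, b j) ^ 2 ≤ 0 := by
      intro t ht
      have := ih (Function.update b i t) (by
        intro j
        by_cases hj : j = i
        · subst hj
          simp only [Function.update_self]
          rcases ht with rfl | rfl
          · exact ⟨le_rfl, hpq⟩
          · exact ⟨hpq, le_rfl⟩
        · simpa [Function.update_of_ne hj] using hb j) (by
        intro j hjS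
        by_cases hj : j = i
        · subst hj; simpa using ht
        · rw [Function.update_of_ne hj]; exact h j (by simp [hj, hjS]))
      rw [← Finset.add_sum_erase univ _ (mem_univ i),
        ← Finset.add_sum_erase univ (Function.update b i t) (mem_univ i)] at this
      have e1 : ∑ j ∈ univ.erase i, (Function.update b i t j) ^ 2 = ∑ j ∈ univ.erase i, b j ^ 2 :=
        Finset.sum_congr rfl (fun j hj => by rw [Function.update_of_ne (Finset.ne_of_mem_erase hj)])
      have e2 : ∑ j ∈ univ.erase i, (Function.update b i t j) = ∑ j ∈ univ.erase i, b j :=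
        Finset.sum_congr rfl (fun j hj => by rw [Function.update_of_ne (Finset.ne_of_mem_erase hj)])
      rw [e1, e2] at this
      simpa using this
    rw [← Finset.add_sum_erase univ _ (mem_univ i),
        ← Finset.add_sum_erase univ b (mem_univ i)]
    exact quad_box _ _ k p q (b i) hk (hb i).1 (hb i).2 (key p (Or.inl rfl)) (key q (Or.inr rfl))

lemma two_val_sum {d : ℕ} (A : Finset (Fin d)) (u v : ℝ) :
    ∑ i, (if i ∈ A then u else v) = (A.card : ℝ) * u + ((d : ℝ) - A.card) * v := by
  have : ∀ i, (if i ∈ A then u else v) = v + (if i ∈ A then u - v else 0) := by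
    intro i; split_ifs <;> ring
  simp_rw [this, Finset.sum_add_distrib]
  simp
  ring

lemma cap_bound (d : ℕ) (hd : 2 ≤ d) (lam : ℝ) (hlam : 1 < lam) (a : Fin d → ℝ) (τ : ℝ)
    (hτ : ∀ s : ℕ, s ≤ d → (d : ℝ) * s * (d - s) * (lam - 1) ^ 2 ≤ τ * (d + s * (lam - 1)) ^ 2)
    (hτ2 : τ ≤ (d : ℝ) ^ 2 - d)
    (hs : ∑ i, a i = (d : ℝ)) (h : ∀ i j, a i ≤ lam * a j) :
    (∑ i, a i ^ 2) - (d : ℝ) ≤ τ := by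
  classical
  have hd0 : (0 : ℝ) < d := by positivity
  haveI : NeZero d := ⟨by omega⟩
  obtain ⟨i0, -, hi0⟩ := Finset.exists_min_image univ a ⟨0, mem_univ _⟩
  set m := a i0 with hm
  have hm0 : 0 < m := by
    by_contra hc
    push Not at hc
    have : ∑ i, a i ≤ ∑ i : Fin d, (0 : ℝ) := Finset.sum_le_sum (fun i _ => by
      have := h i i0
      nlinarith)
    simp at this
    linarith
  have hk : ((d : ℝ) + τ) / d ^ 2 ≤ 1 := by
    rw [div_le_one (by positivity)]; linarith
  have := box_max (((d : ℝ) + τ) / d ^ 2) m (lam * m) hk (by nlinarith) (by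
    intro b hb
    set A := univ.filter (fun i => b i = lam * m) with hA
    have hbA : ∀ i, b i = if i ∈ A then lam * m else m := by
      intro i
      by_cases hi : b i = lam * m
      · simp [hA, hi]
      · simp [hA, hi]; exact (hb i).resolve_right hi
    have hbA2 : ∀ i, b i ^ 2 = if i ∈ A then (lam * m) ^ 2 else m ^ 2 := by
      intro i; rw [hbA i]; split_ifs <;> rfl
    simp_rw [hbA2]
    rw [Finset.sum_congr rfl (fun i _ => hbA i), two_val_sum, two_val_sum]
    have hc : A.card ≤ d := by simpa using Finset.card_le_univ A
    have h1 := hτ _ hc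
    have e : (A.card * (lam * m) ^ 2 + ((d : ℝ) - A.card) * m ^ 2) -
        (d + τ) / d ^ 2 * (A.card * (lam * m) + (d - A.card) * m) ^ 2 =
        m ^ 2 / d ^ 2 * (d * A.card * (d - A.card) * (lam - 1) ^ 2 -
          τ * (d + A.card * (lam - 1)) ^ 2) := by
      field_simp
      ring
    rw [e]
    exact mul_nonpos_of_nonneg_of_nonpos (by positivity) (by linarith)) univ a
    (fun i => ⟨hi0 i (mem_univ _), h i i0⟩) (fun i hi => absurd (mem_univ i) hi)
  rw [hs, div_mul_cancel₀ _ (by positivity)] at this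
  linarith

lemma T_step (d u v c : ℝ) (hd : 0 < d) (hc : 0 < c) (hu : 0 < u) (huv : u < v) :
    (v * (c + 2) ≤ d → d * u * (d - u) * c ^ 2 / (d + u * c) ^ 2
      < d * v * (d - v) * c ^ 2 / (d + v * c) ^ 2) ∧
    (d ≤ u * (c + 2) → d * v * (d - v) * c ^ 2 / (d + v * c) ^ 2
      < d * u * (d - u) * c ^ 2 / (d + u * c) ^ 2) := by
  have hv : 0 < v := hu.trans huv
  have e : d * v * (d - v) * c ^ 2 * (d + u * c) ^ 2 - d * u * (d - u) * c ^ 2 * (d + v * c) ^ 2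
      = (d ^ 2 * c ^ 2 * (v - u)) * (d ^ 2 - d * (u + v) - u * v * (c * (c + 2))) := by ring
  have hp : 0 < d ^ 2 * c ^ 2 * (v - u) := by have := sub_pos.2 huv; positivity
  constructor
  · intro h
    rw [div_lt_div_iff₀ (by positivity) (by positivity)]
    have : 0 < d ^ 2 - d * (u + v) - u * v * (c * (c + 2)) := by
      have h1 : v * (c + 2) * (u * c) ≤ d * (u * c) := by gcongr
      have h2 : u * (c + 2) < d := lt_of_lt_of_le (by gcongr) h
      have h3 : v * (c + 2) * d ≤ d * d := by gcongr
      have h4 : u * (c + 1) * d < v * (c + 1) * d := by gcongr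
      nlinarith
    nlinarith [mul_pos hp this]
  · intro h
    rw [div_lt_div_iff₀ (by positivity) (by positivity)]
    have : d ^ 2 - d * (u + v) - u * v * (c * (c + 2)) < 0 := by
      have h1 : d * (v * c) ≤ u * (c + 2) * (v * c) := by gcongr
      have h3 : d * d ≤ u * (c + 2) * d := by gcongr
      have h4 : u * (c + 1) * d < v * (c + 1) * d := by gcongr
      nlinarith
    nlinarith [mul_neg_of_pos_of_neg hp this]

/-- **exact raw-cap trace maximization.** Let `d ≥ 2`, `λ > 1`, and for
`1 ≤ s ≤ d-1` set `T_{d,λ}(s) = d·s(d-s)(λ-1)²/(d + s(λ-1))²`, with maximum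
`T_d^*(λ)`.  Then: (i) the maximum of `∑ aᵢ² - d` over the ratio-capped polytope
`𝒦_{d,λ}` equals `T_d^*(λ)` (and is attained); (ii) every anchored law `ρ` whose
channel is `ε₀`-LDP with `λ = e^{ε₀}` (i.e. `1 + γᵢᵀx ≤ λ(1 + γⱼᵀx)` for all `i,j`,
`ρ`-a.s.) obeys `tr Σ(ρ) ≤ T_d^*(λ)`; (iii) every integer maximizer of `T_{d,λ}` lies
in `{⌊d/(λ+1)⌋, ⌈d/(λ+1)⌉} ∩ {1,…,d-1}`. -/
theorem stmt19 (d : ℕ) (hd : 2 ≤ d) (lam : ℝ) (hlam : 1 < lam)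
    (H : Matrix (Fin d) (Fin (d - 1)) ℝ)
    (horth : H.transpose * H = 1)
    (hcolsum : ∀ j, ∑ i, H i j = 0) :
    let K : Set (Fin d → ℝ) :=
      {a | (∀ i, 0 ≤ a i) ∧ (∑ i, a i = (d : ℝ)) ∧ ∀ i j, a i ≤ lam * a j}
    let T : ℕ → ℝ := fun s =>
      (d : ℝ) * (s : ℝ) * ((d : ℝ) - (s : ℝ)) * (lam - 1) ^ 2 /
        ((d : ℝ) + (s : ℝ) * (lam - 1)) ^ 2
    let Tstar : ℝ := (Finset.Icc 1 (d - 1)).sup' (Finset.nonempty_Icc.mpr (by omega)) T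
    IsGreatest ((fun a : Fin d → ℝ => (∑ i, (a i) ^ 2) - (d : ℝ)) '' K) Tstar ∧
    (∀ ρ : Measure (Fin (d - 1) → ℝ), IsProbabilityMeasure ρ →
      ρ {x | ∀ i, 0 ≤ 1 + ∑ j, H i j * x j}ᶜ = 0 →
      (∫ x, x ∂ρ) = 0 →
      (∀ᵐ x ∂ρ, ∀ i j, 1 + ∑ l, H i l * x l ≤ lam * (1 + ∑ l, H j l * x l)) →
      (Matrix.of fun j k : Fin (d - 1) => ∫ x, x j * x k ∂ρ).trace ≤ Tstar) ∧
    (∀ s : ℕ, 1 ≤ s → s ≤ d - 1 → (∀ s' : ℕ, 1 ≤ s' → s' ≤ d - 1 → T s' ≤ T s) →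
      s = Nat.floor ((d : ℝ) / (lam + 1)) ∨ s = Nat.ceil ((d : ℝ) / (lam + 1))) := by
  classical
  intro K T Tstar
  have hd0 : (0 : ℝ) < d := by positivity
  have hd2 : (2 : ℝ) ≤ d := by exact_mod_cast hd
  have hc : 0 < lam - 1 := by linarith
  have hle : ∀ s : ℕ, 1 ≤ s → s ≤ d - 1 → T s ≤ Tstar := fun s h1 h2 =>
    Finset.le_sup' T (Finset.mem_Icc.2 ⟨h1, h2⟩)
  obtain ⟨s0, hs0, hs0T⟩ := Finset.exists_mem_eq_sup' (Finset.nonempty_Icc.mpr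
    (show 1 ≤ d - 1 by omega)) T
  have hs0T : Tstar = T s0 := hs0T
  rw [Finset.mem_Icc] at hs0
  have hs01 : (1 : ℝ) ≤ s0 := by exact_mod_cast hs0.1
  have hs0d : (s0 : ℝ) ≤ d := by exact_mod_cast (by omega : s0 ≤ d)
  have hnn : 0 ≤ Tstar := by
    rw [hs0T]
    have := sub_nonneg.2 hs0d
    simp only [T]
    positivity
  have hτ : ∀ s : ℕ, s ≤ d →
      (d : ℝ) * s * (d - s) * (lam - 1) ^ 2 ≤ Tstar * (d + s * (lam - 1)) ^ 2 := by
    intro s hs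
    rcases Nat.eq_zero_or_pos s with rfl | h0
    · simp; positivity
    rcases eq_or_lt_of_le hs with rfl | h1
    · simp; positivity
    have := hle s h0 (by omega)
    simp only [T] at this
    rwa [div_le_iff₀ (by positivity)] at this
  have hτ2 : Tstar ≤ (d : ℝ) ^ 2 - d := by
    rw [hs0T]
    simp only [T]
    rw [div_le_iff₀ (by positivity)]
    have h1 : (s0 : ℝ) * (d - s0) ≤ (d - 1) * s0 ^ 2 := by
      nlinarith [mul_nonneg (mul_nonneg hd0.le (by linarith : (0 : ℝ) ≤ s0)) (sub_nonneg.2 hs01)]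
    have h2 : ((s0 : ℝ) * (lam - 1)) ^ 2 ≤ (d + s0 * (lam - 1)) ^ 2 := by
      gcongr
      linarith
    have h3 : (d * (lam - 1) ^ 2) * ((s0 : ℝ) * (d - s0)) ≤
      (d * (lam - 1) ^ 2) * ((d - 1) * s0 ^ 2) := by gcongr
    have h4 : ((d : ℝ) * (d - 1)) * ((s0 : ℝ) * (lam - 1)) ^ 2 ≤
      (d * (d - 1)) * (d + s0 * (lam - 1)) ^ 2 := by
      have : (0 : ℝ) ≤ d - 1 := by linarith
      gcongr
    nlinarith
  have hbd : ∀ a : Fin d → ℝ, ∑ i, a i = (d : ℝ) → (∀ i j, a i ≤ lam * a j) →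
      (∑ i, a i ^ 2) - (d : ℝ) ≤ Tstar := fun a h1 h2 =>
    cap_bound d hd lam hlam a Tstar hτ hτ2 h1 h2
  refine ⟨⟨?_, ?_⟩, ?_, ?_⟩
  · obtain ⟨A, -, hA⟩ := Finset.exists_subset_card_eq
      (s := (univ : Finset (Fin d))) (n := s0) (by simp; omega)
    have hD : (0 : ℝ) < d + s0 * (lam - 1) := by positivity
    set m : ℝ := d / (d + s0 * (lam - 1)) with hm
    have hm0 : 0 < m := by positivity
    refine ⟨fun i => if i ∈ A then lam * m else m, ⟨?_, ?_, ?_⟩, ?_⟩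
    · intro i
      dsimp only
      split_ifs <;> positivity
    · rw [two_val_sum, hA, hm]
      field_simp
      ring
    · intro i j
      dsimp only
      have h1 : m ≤ lam * m := by nlinarith
      have h2 : lam * m ≤ lam * (lam * m) := by gcongr
      split_ifs <;> linarith
    · have : ∀ i, (if i ∈ A then lam * m else m) ^ 2 =
          if i ∈ A then (lam * m) ^ 2 else m ^ 2 := by
        intro i; split_ifs <;> rfl
      simp only [this]
      rw [two_val_sum, hA, hs0T, hm]
      simp only [T]
      field_simp
      ring
  · rintro _ ⟨a, ⟨_, h1, h2⟩, rfl⟩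
    exact hbd a h1 h2
  · intro ρ hρ _ _ hcap
    have hpt : ∀ᵐ x ∂ρ, ∑ j, x j * x j ≤ Tstar := by
      filter_upwards [hcap] with x hx
      have hsum0 : ∑ i, ∑ l, H i l * x l = 0 := by
        rw [Finset.sum_comm]
        simp [← Finset.sum_mul, hcolsum]
      have h1 := hbd (fun i => 1 + ∑ l, H i l * x l) (by
        rw [Finset.sum_add_distrib, hsum0]; simp) hx
      have h2 : ∑ i, (∑ l, H i l * x l) ^ 2 = ∑ j, x j * x j := by
        have e1 : ∑ i, (∑ l, H i l * x l) ^ 2 = (H.mulVec x) ⬝ᵥ (H.mulVec x) := by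
          simp [dotProduct, Matrix.mulVec, sq]
        rw [e1, Matrix.dotProduct_mulVec, ← Matrix.mulVec_transpose, Matrix.mulVec_mulVec, horth,
          Matrix.one_mulVec]
        rfl
      have h3 : ∑ i, (1 + ∑ l, H i l * x l) ^ 2 = d + ∑ j, x j * x j := by
        have : ∀ i, (1 + ∑ l, H i l * x l) ^ 2 =
            1 + 2 * (∑ l, H i l * x l) + (∑ l, H i l * x l) ^ 2 := fun i => by ring
        simp_rw [this]
        rw [Finset.sum_add_distrib, Finset.sum_add_distrib, h2, ← Finset.mul_sum, hsum0]
        simp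
      simp only [h3] at h1
      linarith
    have hint : ∀ j : Fin (d - 1), Integrable (fun x : Fin (d - 1) → ℝ => x j * x j) ρ := by
      intro j
      refine Integrable.of_bound (by fun_prop) Tstar ?_
      filter_upwards [hpt] with x hx
      rw [Real.norm_of_nonneg (mul_self_nonneg _)]
      exact (Finset.single_le_sum (f := fun j => x j * x j)
        (fun i _ => mul_self_nonneg _) (mem_univ j)).trans hx
    simp only [Matrix.trace, Matrix.diag, Matrix.of_apply]
    rw [← integral_finset_sum _ (fun j _ => hint j)]
    calc _ ≤ ∫ _x, Tstar ∂ρ := integral_mono_ae (integrable_finset_sum _ (fun j _ => hint j))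
            (integrable_const _) hpt
      _ = Tstar := by simp
  · intro s h1 h2 hmax
    have hl1 : 0 < lam + 1 := by linarith
    by_contra hne
    push Not at hne
    obtain ⟨hf, hcl⟩ := hne
    have hsR : (0 : ℝ) < s := by exact_mod_cast h1
    have hx0 : 0 < (d : ℝ) / (lam + 1) := by positivity
    rcases lt_trichotomy s (Nat.floor ((d : ℝ) / (lam + 1))) with h | h | h
    · have h3 : ((s + 1 : ℕ) : ℝ) ≤ d / (lam + 1) := (Nat.le_floor_iff hx0.le).1 h
      have h4 : ((s + 1 : ℕ) : ℝ) * (lam + 1) ≤ d := (le_div_iff₀ hl1).1 h3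
      have h5 : s + 1 ≤ d - 1 := by
        have : ((s + 1 : ℕ) : ℝ) * 2 ≤ d := le_trans (by gcongr; linarith) h4
        have : (s + 1) * 2 ≤ d := by exact_mod_cast this
        omega
      have h6 := (T_step d s ((s + 1 : ℕ) : ℝ) (lam - 1) hd0 hc hsR (by push_cast; linarith)).1
        (by linarith)
      exact absurd (hmax (s + 1) (by omega) h5) (not_le.2 h6)
    · exact hf h
    · have h3 : Nat.ceil ((d : ℝ) / (lam + 1)) < s := by
        have := Nat.ceil_le_floor_add_one ((d : ℝ) / (lam + 1))
        omega
      have h7 : 0 < Nat.ceil ((d : ℝ) / (lam + 1)) := Nat.ceil_pos.2 hx0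
      have h4 : (d : ℝ) / (lam + 1) ≤ ((s - 1 : ℕ) : ℝ) := Nat.ceil_le.1 (by omega)
      rw [div_le_iff₀ hl1] at h4
      have h8 : (0 : ℝ) < ((s - 1 : ℕ) : ℝ) := by exact_mod_cast (by omega : 0 < s - 1)
      have h6 := (T_step d ((s - 1 : ℕ) : ℝ) s (lam - 1) hd0 hc h8
        (by exact_mod_cast (by omega : s - 1 < s))).2 (by linarith)
      exact absurd (hmax (s - 1) (by omega) (by omega)) (not_le.2 h6)
end
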